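/- Let c > 1 be an odd integer and let a be any integer. Then, as n → ∞, v(a,c;n) ~ e^{π√n}/(16·c·n^{3/4}), i.e. the ratio of the two sides tends to 1. -/

import Mathlib

open Complex Real Filter Topology

noncomputable section

/-- An odd-balanced unimodal sequence, encoded as (left list `L`, peak `p`, right list `R`):
all parts positive, the peak `p` is even and strictly larger than all other parts,
the left side is weakly increasing and the right side weakly decreasing, repeated
(i.e. equal consecutive) parts are allowed only when they are odd, and the odd parts
before the peak are identical to the odd parts after the peak. -/
def IsOddBalanced (L : List ℕ) (p : ℕ) (R : List ℕ) : Prop :=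
  Even p ∧ 0 < p ∧ (∀ x ∈ L, 0 < x) ∧ (∀ x ∈ R, 0 < x) ∧
  L.Chain' (fun a b => a ≤ b ∧ (a = b → Odd a)) ∧
  R.Chain' (fun a b => b ≤ a ∧ (a = b → Odd a)) ∧
  (∀ x ∈ L, x < p) ∧ (∀ x ∈ R, x < p) ∧
  L.filter (fun x => x % 2 == 1) = R.reverse.filter (fun x => x % 2 == 1)

/-- `v(m,n)`: number of odd-balanced unimodal sequences of size `2n+2` and rank `m`. -/
def oddBalancedCount (m : ℤ) (n : ℕ) : ℕ :=
  Nat.card {x : List ℕ × ℕ × List ℕ //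
    IsOddBalanced x.1 x.2.1 x.2.2 ∧ x.1.sum + x.2.1 + x.2.2.sum = 2 * n + 2 ∧
    (x.2.2.length : ℤ) - (x.1.length : ℤ) = m}

/-- `v(a,c;n)`: number of odd-balanced unimodal sequences of size `2n+2`
whose rank is congruent to `a` modulo `c`. -/
def oddBalancedCountMod (a : ℤ) (c : ℕ) (n : ℕ) : ℕ :=
  Nat.card {x : List ℕ × ℕ × List ℕ //
    IsOddBalanced x.1 x.2.1 x.2.2 ∧ x.1.sum + x.2.1 + x.2.2.sum = 2 * n + 2 ∧
    (x.2.2.length : ℤ) - (x.1.length : ℤ) ≡ a [ZMOD (c : ℤ)]}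

/-- `v(n)`: total number of odd-balanced unimodal sequences of size `2n+2`. -/
def oddBalancedTotal (n : ℕ) : ℕ :=
  Nat.card {x : List ℕ × ℕ × List ℕ //
    IsOddBalanced x.1 x.2.1 x.2.2 ∧ x.1.sum + x.2.1 + x.2.2.sum = 2 * n + 2}

/-- Overpartition function `p̄(n)`: each partition of `n` is counted with
multiplicity `2^(number of distinct parts)` (the overlined parts), which matches the
generating function `∏ (1+qⁿ)/(1-qⁿ)`. -/
def overpartition (n : ℕ) : ℕ := ∑ p : n.Partition, 2 ^ p.parts.toFinset.card

open Complex Real Filter Topology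
noncomputable section

/-! ### Part I: combinatorial encoding -/

/-- the relation used on the left side -/
def OBRel (a b : ℕ) : Prop := a ≤ b ∧ (a = b → Odd a)

instance : Trans OBRel OBRel OBRel where
  trans := by
    intro a b c h1 h2
    refine ⟨h1.1.trans h2.1, fun h => h1.2 ?_⟩
    have := h1.1; have := h2.1; omega

lemma pairwise_odd_iff (l : List ℕ) :
    l.Pairwise (fun a b => a = b → Odd a) ↔ ∀ a, ¬ Odd a → l.count a ≤ 1 := by
  induction l with
  | nil => simp
  | cons x l ih =>
    rw [List.pairwise_cons, ih]
    constructor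
    · rintro ⟨h1, h2⟩ a ha
      rw [List.count_cons]
      by_cases hx : x = a
      · subst hx
        have : l.count x = 0 := List.count_eq_zero.2 (fun hm => ha (h1 x hm rfl))
        simp [this]
      · simpa [hx] using h2 a ha
    · intro h
      refine ⟨?_, ?_⟩
      · rintro b hb rfl
        by_contra hodd
        have := h x hodd
        rw [List.count_cons] at this
        have h3 := List.count_pos_iff.2 hb
        simp at this
        omega
      · intro a ha
        have := h a ha
        rw [List.count_cons] at this
        omega

lemma chain_iff (l : List ℕ) :
    l.IsChain OBRel ↔ l.Pairwise (· ≤ ·) ∧ ∀ a, ¬ Odd a → l.count a ≤ 1 := by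
  rw [List.isChain_iff_pairwise, ← pairwise_odd_iff]
  exact List.pairwise_and_iff

/-- data: peak `2k+2`, even parts left, right, and multiplicities of odd parts -/
abbrev OBData : Type := Σ k : ℕ, (Finset (Fin k) × Finset (Fin k)) × (Fin (k+1) → ℕ)

/-- multiset of parts on one side -/
def sideM {k : ℕ} (A : Finset (Fin k)) (f : Fin (k+1) → ℕ) : Multiset ℕ :=
  (∑ i ∈ A, {2 * (i:ℕ) + 2}) + ∑ j, f j • {2 * (j:ℕ) + 1}

lemma sideM_sum {k : ℕ} (A : Finset (Fin k)) (f : Fin (k+1) → ℕ) :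
    (sideM A f).sum = 2 * (∑ i ∈ A, ((i:ℕ)+1)) + ∑ j, f j * (2 * (j:ℕ) + 1) := by
  simp only [sideM, Multiset.sum_add, Multiset.sum_sum, Multiset.sum_singleton,
    Multiset.sum_nsmul, smul_eq_mul, Finset.mul_sum]
  rfl

lemma sideM_card {k : ℕ} (A : Finset (Fin k)) (f : Fin (k+1) → ℕ) :
    (sideM A f).card = A.card + ∑ j, f j := by
  simp [sideM, Multiset.card_sum]

lemma sideM_count_even {k : ℕ} (A : Finset (Fin k)) (f : Fin (k+1) → ℕ) (i : Fin k) :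
    (sideM A f).count (2 * (i:ℕ) + 2) = if i ∈ A then 1 else 0 := by
  rw [sideM, Multiset.count_add, Multiset.count_sum', Multiset.count_sum']
  have h2 : ∀ j : Fin (k+1), Multiset.count (2 * (i:ℕ) + 2) (f j • {2 * (j:ℕ) + 1}) = 0 := by
    intro j
    rw [Multiset.count_nsmul, Multiset.count_singleton, if_neg (by omega), mul_zero]
  have h1 : ∀ j : Fin k, Multiset.count (2 * (i:ℕ) + 2) {2 * (j:ℕ) + 2} = if i = j then 1 else 0 := by
    intro j
    rw [Multiset.count_singleton]
    congr 1
    rw [Fin.ext_iff, eq_iff_iff]; omega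
  simp [h1, h2]

lemma sideM_count_odd {k : ℕ} (A : Finset (Fin k)) (f : Fin (k+1) → ℕ) (j : Fin (k+1)) :
    (sideM A f).count (2 * (j:ℕ) + 1) = f j := by
  rw [sideM, Multiset.count_add, Multiset.count_sum', Multiset.count_sum']
  have h2 : ∀ i : Fin (k+1), Multiset.count (2 * (j:ℕ) + 1) (f i • {2 * (i:ℕ) + 1})
      = if j = i then f i else 0 := by
    intro i
    rw [Multiset.count_nsmul, Multiset.count_singleton]
    by_cases h : j = i
    · simp [h]
    · rw [if_neg, if_neg h, mul_zero]
      rw [Fin.ext_iff] at h; omega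
  have h1 : ∀ i : Fin k, Multiset.count (2 * (j:ℕ) + 1) {2 * (i:ℕ) + 2} = 0 := by
    intro i
    rw [Multiset.count_singleton, if_neg (by omega)]
  simp [h1, h2]

lemma sideM_mem {k : ℕ} (A : Finset (Fin k)) (f : Fin (k+1) → ℕ) (x : ℕ) (hx : x ∈ sideM A f) :
    (∃ i : Fin k, x = 2 * (i:ℕ) + 2) ∨ (∃ j : Fin (k+1), x = 2 * (j:ℕ) + 1) := by
  rw [sideM, Multiset.mem_add, Multiset.mem_sum, Multiset.mem_sum] at hx
  rcases hx with ⟨i, _, h⟩ | ⟨j, _, h⟩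
  · left; exact ⟨i, by simpa using h⟩
  · right; exact ⟨j, by simpa using Multiset.mem_of_mem_nsmul h⟩

lemma sideM_even_le {k : ℕ} (A : Finset (Fin k)) (f : Fin (k+1) → ℕ) (x : ℕ) (hx : ¬ Odd x) :
    (sideM A f).count x ≤ 1 := by
  by_cases h : x ∈ sideM A f
  · rcases sideM_mem A f x h with ⟨i, rfl⟩ | ⟨j, rfl⟩
    · rw [sideM_count_even]; split_ifs <;> simp
    · exact absurd ⟨(j:ℕ), rfl⟩ hx
  · rw [Multiset.count_eq_zero_of_notMem h]; simp

/-- sorted list -/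
def sideL {k : ℕ} (A : Finset (Fin k)) (f : Fin (k+1) → ℕ) : List ℕ :=
  (sideM A f).sort (· ≤ ·)

lemma sideL_coe {k : ℕ} (A : Finset (Fin k)) (f : Fin (k+1) → ℕ) :
    ((sideL A f : List ℕ) : Multiset ℕ) = sideM A f := Multiset.sort_eq _ _

lemma sideL_sorted {k : ℕ} (A : Finset (Fin k)) (f : Fin (k+1) → ℕ) :
    (sideL A f).Pairwise (· ≤ ·) := Multiset.pairwise_sort _ _

lemma sideL_count {k : ℕ} (A : Finset (Fin k)) (f : Fin (k+1) → ℕ) (x : ℕ) :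
    (sideL A f).count x = (sideM A f).count x := by
  rw [← sideL_coe, Multiset.coe_count]

lemma sideL_mem {k : ℕ} (A : Finset (Fin k)) (f : Fin (k+1) → ℕ) (x : ℕ) :
    x ∈ sideL A f ↔ x ∈ sideM A f := by
  rw [← sideL_coe, Multiset.mem_coe]

lemma sideL_chain {k : ℕ} (A : Finset (Fin k)) (f : Fin (k+1) → ℕ) :
    (sideL A f).IsChain OBRel := by
  rw [chain_iff]
  refine ⟨sideL_sorted A f, fun a ha => ?_⟩
  rw [sideL_count]; exact sideM_even_le A f a ha

lemma sideL_sum {k : ℕ} (A : Finset (Fin k)) (f : Fin (k+1) → ℕ) :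
    (sideL A f).sum = (sideM A f).sum := by
  rw [← sideL_coe, Multiset.sum_coe]

lemma sideL_length {k : ℕ} (A : Finset (Fin k)) (f : Fin (k+1) → ℕ) :
    (sideL A f).length = (sideM A f).card := by
  rw [← sideL_coe, Multiset.coe_card]

lemma eq_of_sorted_count {l₁ l₂ : List ℕ} (h1 : l₁.Pairwise (· ≤ ·)) (h2 : l₂.Pairwise (· ≤ ·))
    (h : ∀ a, l₁.count a = l₂.count a) : l₁ = l₂ :=
  List.Perm.eq_of_pairwise (le := (· ≤ ·)) (fun _ _ _ _ h h' => le_antisymm h h') h1 h2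
    (List.perm_iff_count.2 h)

/-- The encoding map. -/
def encOB (d : OBData) : List ℕ × ℕ × List ℕ :=
  (sideL d.2.1.1 d.2.2, 2 * d.1 + 2, (sideL d.2.1.2 d.2.2).reverse)

lemma isOddBalanced_iff (L : List ℕ) (p : ℕ) (R : List ℕ) : IsOddBalanced L p R.reverse ↔
    Even p ∧ 0 < p ∧ (∀ x ∈ L, 0 < x) ∧ (∀ x ∈ R, 0 < x) ∧
    L.IsChain OBRel ∧ R.IsChain OBRel ∧ (∀ x ∈ L, x < p) ∧ (∀ x ∈ R, x < p) ∧
    L.filter (fun x => x % 2 == 1) = R.filter (fun x => x % 2 == 1) := by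
  unfold IsOddBalanced
  have h1 : List.IsChain (fun a b => b ≤ a ∧ (a = b → Odd a)) R.reverse ↔ R.IsChain OBRel := by
    rw [List.isChain_reverse]
    have : (fun a b : ℕ => a ≤ b ∧ (b = a → Odd b)) = OBRel := by
      funext a b
      simp only [OBRel, eq_iff_iff]
      constructor
      · rintro ⟨h, h'⟩; exact ⟨h, fun e => by subst e; exact h' rfl⟩
      · rintro ⟨h, h'⟩; exact ⟨h, fun e => by subst e; exact h' rfl⟩
    rw [this]
  unfold List.Chain'
  rw [h1]
  simp only [List.mem_reverse, List.reverse_reverse]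
  rfl

lemma encOB_isOddBalanced (d : OBData) :
    IsOddBalanced (encOB d).1 (encOB d).2.1 (encOB d).2.2 := by
  obtain ⟨k, ⟨A, B⟩, f⟩ := d
  simp only [encOB]
  rw [isOddBalanced_iff]
  have hb : ∀ (A : Finset (Fin k)) x, x ∈ sideL A f → 0 < x ∧ x < 2 * k + 2 := by
    intro A x hx
    rw [sideL_mem] at hx
    rcases sideM_mem A f x hx with ⟨i, rfl⟩ | ⟨j, rfl⟩ <;> omega
  refine ⟨⟨k+1, by ring⟩, by omega, fun x hx => (hb A x hx).1, fun x hx => (hb B x hx).1,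
    sideL_chain A f, sideL_chain B f, fun x hx => (hb A x hx).2, fun x hx => (hb B x hx).2, ?_⟩
  apply eq_of_sorted_count
  · exact (sideL_sorted A f).filter _
  · exact (sideL_sorted B f).filter _
  · intro a
    by_cases ha : a % 2 = 1
    · rw [List.count_filter (by simpa using ha), List.count_filter (by simpa using ha),
        sideL_count, sideL_count]
      by_cases hk : a / 2 < k + 1
      · have : a = 2 * ((⟨a/2, hk⟩ : Fin (k+1)) : ℕ) + 1 := by simp; omega
        rw [this, sideM_count_odd, sideM_count_odd]
      · rw [Multiset.count_eq_zero_of_notMem, Multiset.count_eq_zero_of_notMem]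
        · intro hm; rw [← sideL_mem] at hm; have := hb B a hm; omega
        · intro hm; rw [← sideL_mem] at hm; have := hb A a hm; omega
    · rw [List.count_eq_zero_of_not_mem, List.count_eq_zero_of_not_mem] <;>
      · intro h; rw [List.mem_filter] at h; simp at h; omega

lemma encOB_injective : Function.Injective encOB := by
  rintro ⟨k, ⟨A, B⟩, f⟩ ⟨k', ⟨A', B'⟩, f'⟩ h
  simp only [encOB, Prod.mk.injEq] at h
  obtain ⟨h1, h2, h3⟩ := h
  have hk : k = k' := by omega
  subst hk
  have h3 := List.reverse_injective h3
  have e1 : ∀ x, (sideM A f).count x = (sideM A' f').count x := fun x => by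
    rw [← sideL_count, h1, sideL_count]
  have e2 : ∀ x, (sideM B f).count x = (sideM B' f').count x := fun x => by
    rw [← sideL_count, h3, sideL_count]
  have hf : f = f' := by
    funext j
    rw [← sideM_count_odd A f j, e1, sideM_count_odd]
  have hA : A = A' := by
    ext i
    have := e1 (2 * (i:ℕ) + 2)
    rw [sideM_count_even, sideM_count_even] at this
    by_cases h : i ∈ A <;> by_cases h' : i ∈ A' <;> simp_all
  have hB : B = B' := by
    ext i
    have := e2 (2 * (i:ℕ) + 2)
    rw [sideM_count_even, sideM_count_even] at this
    by_cases h : i ∈ B <;> by_cases h' : i ∈ B' <;> simp_all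
  subst hf hA hB
  rfl

lemma sideL_of_list (k : ℕ) (L : List ℕ) (h0 : ∀ x ∈ L, 0 < x) (hp : ∀ x ∈ L, x < 2 * k + 2)
    (hc : L.IsChain OBRel) (f : Fin (k+1) → ℕ) (hf : ∀ j : Fin (k+1), f j = L.count (2 * (j:ℕ) + 1)) :
    sideL (Finset.univ.filter (fun i : Fin k => 2 * (i:ℕ) + 2 ∈ L)) f = L := by
  rw [chain_iff] at hc
  apply eq_of_sorted_count (sideL_sorted _ _) hc.1
  intro a
  rw [sideL_count]
  by_cases hr : 0 < a ∧ a < 2 * k + 2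
  · by_cases ho : a % 2 = 1
    · have : a = 2 * ((⟨a/2, by omega⟩ : Fin (k+1)) : ℕ) + 1 := by simp; omega
      rw [this, sideM_count_odd, hf]
    · have h2 : a = 2 * ((⟨a/2-1, by omega⟩ : Fin k) : ℕ) + 2 := by simp; omega
      rw [h2, sideM_count_even, ← h2]
      have hc2 := hc.2 a (by rw [Nat.odd_iff]; exact ho)
      simp only [Finset.mem_filter, Finset.mem_univ, true_and, ← h2]
      by_cases hm : a ∈ L
      · have := List.count_pos_iff.2 hm
        rw [if_pos hm]; omega
      · rw [if_neg hm, List.count_eq_zero_of_not_mem hm]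
  · rw [Multiset.count_eq_zero_of_notMem, List.count_eq_zero_of_not_mem]
    · intro h; exact hr ⟨h0 _ h, hp _ h⟩
    · intro h
      rcases sideM_mem _ f a h with ⟨i, rfl⟩ | ⟨j, rfl⟩ <;> omega

lemma encOB_surj (x : List ℕ × ℕ × List ℕ) (hx : IsOddBalanced x.1 x.2.1 x.2.2) :
    ∃ d, encOB d = x := by
  obtain ⟨L, p, R0⟩ := x
  obtain ⟨R, rfl⟩ : ∃ R : List ℕ, R0 = R.reverse := ⟨R0.reverse, by simp⟩
  simp only at hx
  rw [isOddBalanced_iff] at hx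
  obtain ⟨he, hp, hL0, hR0, hLc, hRc, hLp, hRp, hfil⟩ := hx
  obtain ⟨k, rfl⟩ : ∃ k, p = 2 * k + 2 := by
    obtain ⟨m, hm⟩ := he
    exact ⟨m - 1, by omega⟩
  refine ⟨⟨k, (Finset.univ.filter (fun i : Fin k => 2 * (i:ℕ) + 2 ∈ L),
    Finset.univ.filter (fun i : Fin k => 2 * (i:ℕ) + 2 ∈ R)), fun j => L.count (2 * (j:ℕ) + 1)⟩, ?_⟩
  simp only [encOB]
  rw [sideL_of_list k L hL0 hLp hLc _ (fun j => rfl), sideL_of_list k R hR0 hRp hRc]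
  intro j
  have := congrArg (List.count (2 * (j:ℕ) + 1)) hfil
  rwa [List.count_filter (by simp), List.count_filter (by simp)] at this

/-- size -/
def szOB (d : OBData) : ℕ :=
  d.1 + ∑ i ∈ d.2.1.1, ((i:ℕ)+1) + ∑ i ∈ d.2.1.2, ((i:ℕ)+1) + ∑ j, d.2.2 j * (2 * (j:ℕ) + 1)

/-- rank -/
def rkOB (d : OBData) : ℤ := (d.2.1.2.card : ℤ) - (d.2.1.1.card : ℤ)

lemma encOB_size (d : OBData) :
    (encOB d).1.sum + (encOB d).2.1 + (encOB d).2.2.sum = 2 * szOB d + 2 := by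
  simp only [encOB, List.sum_reverse, sideL_sum, sideM_sum, szOB]
  ring

lemma encOB_rank (d : OBData) :
    ((encOB d).2.2.length : ℤ) - ((encOB d).1.length : ℤ) = rkOB d := by
  simp only [encOB, List.length_reverse, sideL_length, sideM_card, rkOB]
  push_cast; ring

lemma oddBalancedCountMod_eq (a : ℤ) (c n : ℕ) :
    oddBalancedCountMod a c n = Nat.card {d : OBData // szOB d = n ∧ rkOB d ≡ a [ZMOD (c:ℤ)]} := by
  symm
  unfold oddBalancedCountMod
  refine Nat.card_congr (Equiv.ofBijective (fun d => ⟨encOB d.1, encOB_isOddBalanced d.1, ?_, ?_⟩) ⟨?_, ?_⟩)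
  · rw [encOB_size, d.2.1]
  · rw [encOB_rank]; exact d.2.2
  · intro d d' h
    simp only [Subtype.mk.injEq] at h
    exact Subtype.ext (encOB_injective h)
  · rintro ⟨x, hx, hs, hr⟩
    obtain ⟨d, rfl⟩ := encOB_surj x hx
    rw [encOB_size] at hs
    rw [encOB_rank] at hr
    exact ⟨⟨d, by omega, hr⟩, rfl⟩
end

open Complex Real Filter Topology
noncomputable section

/-! ### Part II: the products -/

/-- the summand of `V(w;q)` without the factor `q^n` -/
def PP {K : Type*} [Field K] (w q : K) (n : ℕ) : K :=
  (∏ k ∈ Finset.range n, ((1 + w * q^(k+1)) * (1 + w⁻¹ * q^(k+1)))) /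
    ∏ j ∈ Finset.range (n+1), (1 - q^(2*j+1))

lemma hasSum_pi_geom {K : Type*} [NormedField K] [CompleteSpace K] (n : ℕ) (x : Fin n → K)
    (hx : ∀ j, ‖x j‖ < 1) :
    HasSum (fun f : Fin n → ℕ => ∏ j, x j ^ f j) (∏ j, (1 - x j)⁻¹) ∧
    Summable (fun f : Fin n → ℕ => ‖∏ j, x j ^ f j‖) := by
  induction n with
  | zero => exact ⟨by simp [hasSum_unique],
      Summable.of_finite⟩
  | succ n ih =>
    obtain ⟨h1, h2⟩ := ih (fun j => x j.succ) (fun j => hx _)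
    have g1 := hasSum_geometric_of_norm_lt_one (hx 0)
    have g2 : Summable (fun i : ℕ => ‖x 0 ^ i‖) := by
      simpa using summable_geometric_of_lt_one (norm_nonneg _) (hx 0)
    have hs : Summable (fun p : ℕ × (Fin n → ℕ) => x 0 ^ p.1 * ∏ j, x (Fin.succ j) ^ p.2 j) :=
      summable_mul_of_summable_norm (f := fun i : ℕ => x 0 ^ i)
        (g := fun p : Fin n → ℕ => ∏ j, x (Fin.succ j) ^ p j) g2 h2
    have hs' : Summable (fun p : ℕ × (Fin n → ℕ) => ‖x 0 ^ p.1 * ∏ j, x (Fin.succ j) ^ p.2 j‖) := by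
      have := g2.mul_of_nonneg h2 (fun _ => norm_nonneg _) (fun _ => norm_nonneg _)
      simpa [norm_mul] using this
    have hm := g1.mul h1 hs
    rw [Fin.prod_univ_succ]
    have e := Fin.consEquiv (fun _ : Fin (n+1) => ℕ)
    constructor
    · rw [← (Fin.consEquiv (fun _ : Fin (n+1) => ℕ)).hasSum_iff]
      convert! hm using 2 with p
      simp [Fin.consEquiv, Fin.prod_univ_succ]
    · rw [← (Fin.consEquiv (fun _ : Fin (n+1) => ℕ)).summable_iff]
      convert! hs' using 2 with p
      simp [Fin.consEquiv, Fin.prod_univ_succ]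

lemma term_eq {K : Type*} [Field K] (w q : K) (hw : w ≠ 0) (k : ℕ) (A B : Finset (Fin k))
    (f : Fin (k+1) → ℕ) :
    w ^ (rkOB ⟨k, (A, B), f⟩) * q ^ (szOB ⟨k, (A, B), f⟩) =
    q^k * (((∏ i ∈ A, (w⁻¹ * q^((i:ℕ)+1))) * (∏ i ∈ B, (w * q^((i:ℕ)+1)))) *
      ∏ j : Fin (k+1), (q ^ (2*(j:ℕ)+1)) ^ f j) := by
  have h3 : ∏ j : Fin (k+1), (q ^ (2*(j:ℕ)+1)) ^ f j = q ^ (∑ j, f j * (2 * (j:ℕ) + 1)) := by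
    rw [← Finset.prod_pow_eq_pow_sum]
    exact Finset.prod_congr rfl fun j _ => by rw [← pow_mul, mul_comm]
  rw [h3]
  simp only [rkOB, szOB, Finset.prod_mul_distrib, Finset.prod_const, Finset.prod_pow_eq_pow_sum]
  rw [pow_add, pow_add, pow_add, zpow_sub₀ hw, zpow_natCast, zpow_natCast, inv_pow]
  field_simp

lemma hasSum_fixed {K : Type*} [NormedField K] [CompleteSpace K] (w q : K) (hw : w ≠ 0)
    (hq : ‖q‖ < 1) (k : ℕ) :
    HasSum (fun x : (Finset (Fin k) × Finset (Fin k)) × (Fin (k+1) → ℕ) =>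
      w ^ (rkOB ⟨k, x⟩) * q ^ (szOB ⟨k, x⟩)) (q^k * PP w q k) := by
  have hg := hasSum_pi_geom (k+1) (fun j => q ^ (2*(j:ℕ)+1)) (fun j => by
    rw [norm_pow]; exact pow_lt_one₀ (norm_nonneg _) hq (by omega))
  have hAB : HasSum (fun x : Finset (Fin k) × Finset (Fin k) =>
      (∏ i ∈ x.1, (w⁻¹ * q^((i:ℕ)+1))) * (∏ i ∈ x.2, (w * q^((i:ℕ)+1))))
      ((∏ i : Fin k, (1 + w⁻¹ * q^((i:ℕ)+1))) * (∏ i : Fin k, (1 + w * q^((i:ℕ)+1)))) := by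
    rw [Finset.prod_one_add, Finset.prod_one_add, Finset.sum_mul_sum]
    simp only [Finset.powerset_univ]
    rw [← Finset.sum_product']
    exact hasSum_fintype _
  have hs := summable_mul_of_summable_norm (f := fun x : Finset (Fin k) × Finset (Fin k) =>
      (∏ i ∈ x.1, (w⁻¹ * q^((i:ℕ)+1))) * (∏ i ∈ x.2, (w * q^((i:ℕ)+1)))) Summable.of_finite hg.2
  have := (hAB.mul hg.1 hs).mul_left (q^k)
  convert! this using 1
  · funext x
    obtain ⟨⟨A, B⟩, f⟩ := x
    exact term_eq w q hw k A B f
  · rw [PP, Finset.prod_mul_distrib, Finset.prod_range, Finset.prod_range, Finset.prod_range,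
      div_eq_mul_inv, Finset.prod_inv_distrib, mul_comm (∏ i : Fin k, (1 + w * q^((i:ℕ)+1)))]

/-- Euler product -/
def EE (q : ℂ) : ℂ := ∏' n : ℕ, (1 - q^(n+1))

/-- limit of `PP 1 q n` -/
def Pinf (q : ℂ) : ℂ := (EE (q^2) / EE q)^3

lemma EE_tendsto (q : ℂ) (hq : ‖q‖ < 1) :
    Tendsto (fun n => ∏ k ∈ Finset.range n, (1 - q^(k+1))) atTop (𝓝 (EE q)) :=
  (ModularForm.multipliable_one_sub_pow hq).hasProd.tendsto_prod_nat

lemma one_sub_pow_ne {K : Type*} [NormedField K] {q : K} (hq : ‖q‖ < 1) {m : ℕ} (hm : m ≠ 0) :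
    1 - q^m ≠ 0 := by
  intro h
  have h1 : ‖q^m‖ < 1 := by rw [norm_pow]; exact pow_lt_one₀ (norm_nonneg _) hq hm
  rw [← sub_eq_zero.1 h] at h1
  simp at h1

lemma EE_ne (q : ℂ) (hq : ‖q‖ < 1) : EE q ≠ 0 := by
  unfold EE
  simp_rw [sub_eq_add_neg]
  refine tprod_one_add_ne_zero_of_summable ?_ ?_
  · intro i
    rw [← sub_eq_add_neg]
    exact one_sub_pow_ne hq (by omega)
  · simpa using (summable_nat_add_iff 1).mpr (summable_geometric_of_lt_one (norm_nonneg _) hq)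

lemma PP_one_eq (q : ℂ) (hq : ‖q‖ < 1) (n : ℕ) :
    PP 1 q n = ((∏ k ∈ Finset.range n, (1 - (q^2)^(k+1))) / (∏ k ∈ Finset.range n, (1 - q^(k+1))))^2
      * ((∏ k ∈ Finset.range (n+1), (1 - (q^2)^(k+1))) / (∏ k ∈ Finset.range (2*(n+1)), (1 - q^(k+1)))) := by
  have h1 : ∀ n, ∏ k ∈ Finset.range n, (1 - (q^2)^(k+1)) =
      (∏ k ∈ Finset.range n, (1 - q^(k+1))) * (∏ k ∈ Finset.range n, (1 + q^(k+1))) := by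
    intro n
    rw [← Finset.prod_mul_distrib]
    refine Finset.prod_congr rfl fun k _ => ?_
    rw [← pow_mul]; ring
  have h2 : ∀ n, ∏ k ∈ Finset.range (2*n), (1 - q^(k+1)) =
      (∏ j ∈ Finset.range n, (1 - q^(2*j+1))) * ∏ k ∈ Finset.range n, (1 - (q^2)^(k+1)) := by
    intro n
    induction n with
    | zero => simp
    | succ n ih =>
      rw [show 2 * (n+1) = (2*n+1)+1 by ring, Finset.prod_range_succ, Finset.prod_range_succ, ih,
        Finset.prod_range_succ, Finset.prod_range_succ, ← pow_mul]
      ring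
  have n1 : ∀ n, ∏ k ∈ Finset.range n, (1 - q^(k+1)) ≠ 0 := fun n =>
    Finset.prod_ne_zero_iff.2 fun k _ => one_sub_pow_ne hq (by omega)
  have n2 : ∀ n, ∏ k ∈ Finset.range n, (1 - (q^2)^(k+1)) ≠ 0 := fun n =>
    Finset.prod_ne_zero_iff.2 fun k _ => by rw [← pow_mul]; exact one_sub_pow_ne hq (by omega)
  have n3 : ∏ k ∈ Finset.range (n+1), (1 - q^(2*k+1)) ≠ 0 :=
    Finset.prod_ne_zero_iff.2 fun k _ => one_sub_pow_ne hq (by omega)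
  rw [h2, PP]
  simp only [one_mul, inv_one]
  rw [Finset.prod_mul_distrib]
  have := n1 n; have := n2 (n+1)
  have h1n := h1 n
  rw [h1n]
  field_simp

lemma PP_tendsto (q : ℂ) (hq : ‖q‖ < 1) : Tendsto (fun n => PP 1 q n) atTop (𝓝 (Pinf q)) := by
  have hq2 : ‖q^2‖ < 1 := by rw [norm_pow]; exact pow_lt_one₀ (norm_nonneg _) hq (by omega)
  have a1 := EE_tendsto q hq
  have a2 := EE_tendsto (q^2) hq2
  have b1 : Tendsto (fun n => 2*(n+1)) atTop atTop :=
    tendsto_atTop_mono (fun n => by simp; omega) tendsto_id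
  have b2 := a1.comp b1
  have b3 := a2.comp (tendsto_add_atTop_nat 1)
  have := ((a2.div a1 (EE_ne q hq)).pow 2).mul (b3.div b2 (EE_ne q hq))
  rw [Pinf, pow_succ]
  refine this.congr fun n => ?_
  rw [PP_one_eq q hq]
  rfl

/-- real limit -/
def PR (r : ℝ) : ℝ := ‖Pinf (r:ℂ)‖

lemma PP_ofReal (r : ℝ) (n : ℕ) : ((PP (1:ℝ) r n : ℝ) : ℂ) = PP (1:ℂ) (r:ℂ) n := by
  simp [PP]

lemma PP_pos (r : ℝ) (h0 : 0 < r) (h1 : r < 1) (n : ℕ) : 0 < PP (1:ℝ) r n := by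
  unfold PP
  apply div_pos
  · exact Finset.prod_pos fun k _ => by simp; positivity
  · exact Finset.prod_pos fun k _ => by
      have := pow_lt_one₀ h0.le h1 (show 2*k+1 ≠ 0 by omega); linarith

lemma PPr_tendsto (r : ℝ) (h0 : 0 < r) (h1 : r < 1) :
    Tendsto (fun n => PP (1:ℝ) r n) atTop (𝓝 (PR r)) := by
  have := (PP_tendsto (r:ℂ) (by rw [Complex.norm_real, Real.norm_of_nonneg h0.le]; exact h1)).norm
  refine this.congr fun n => ?_
  rw [← PP_ofReal, Complex.norm_real, Real.norm_of_nonneg (PP_pos r h0 h1 n).le]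

lemma PP_succ {K : Type*} [NormedField K] (q : K) (hq : ‖q‖ < 1) (n : ℕ) :
    PP 1 q (n+1) - PP 1 q n = 2 * q^(n+1) * PP 1 q n +
      PP 1 q n * ((q^(2*n+2) + q^(2*n+3) + 2 * q^(3*n+4)) / (1 - q^(2*n+3))) := by
  have e : PP 1 q (n+1) = PP 1 q n * ((1+q^(n+1))^2 / (1 - q^(2*n+3))) := by
    rw [PP, PP, Finset.prod_range_succ, Finset.prod_range_succ (fun j => 1 - q^(2*j+1)),
      show 2*(n+1)+1 = 2*n+3 by ring, mul_div_mul_comm]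
    simp only [one_mul, inv_one]
    ring
  rw [e]
  have := one_sub_pow_ne hq (show 2*n+3 ≠ 0 by omega)
  field_simp
  ring

lemma PP_mono (r : ℝ) (h0 : 0 < r) (h1 : r < 1) : Monotone (fun n => PP (1:ℝ) r n) := by
  refine monotone_nat_of_le_succ fun n => ?_
  have h := PP_succ r (by rwa [Real.norm_of_nonneg h0.le]) n
  have hp := PP_pos r h0 h1 n
  have h3 : 0 < 1 - r^(2*n+3) := by
    have := pow_lt_one₀ h0.le h1 (show 2*n+3 ≠ 0 by omega); linarith
  have : 0 ≤ 2 * r^(n+1) * PP 1 r n + PP 1 r n * ((r^(2*n+2) + r^(2*n+3) + 2 * r^(3*n+4)) / (1 - r^(2*n+3))) := by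
    positivity
  linarith

lemma PP_le (r : ℝ) (h0 : 0 < r) (h1 : r < 1) (n : ℕ) : PP (1:ℝ) r n ≤ PR r :=
  (PP_mono r h0 h1).ge_of_tendsto (PPr_tendsto r h0 h1) n

lemma one_le_PP (r : ℝ) (h0 : 0 < r) (h1 : r < 1) (n : ℕ) : 1 ≤ PP (1:ℝ) r n := by
  refine le_trans ?_ (PP_mono r h0 h1 (Nat.zero_le n))
  simp [PP]
  rw [one_le_inv₀] <;> linarith

lemma PP_norm_le (w q : ℂ) (hw : ‖w‖ = 1) (h0 : 0 < ‖q‖) (hq : ‖q‖ < 1) (n : ℕ) :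
    ‖PP w q n‖ ≤ PP (1:ℝ) ‖q‖ n := by
  rw [PP, PP, norm_div, norm_prod, norm_prod]
  have hb : ∀ u : ℂ, ‖u‖ = 1 → ∀ k, ‖1 + u * q^(k+1)‖ ≤ 1 + ‖q‖^(k+1) := by
    intro u hu k
    refine (norm_add_le _ _).trans ?_
    simp [hu]
  apply div_le_div₀
  · exact Finset.prod_nonneg fun k _ => by simp; positivity
  · apply Finset.prod_le_prod
    · intros; positivity
    · intro k _
      rw [norm_mul]
      have h1 := hb w hw k
      have h2 := hb w⁻¹ (by simp [hw]) k
      simp only [one_mul, inv_one]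
      gcongr
  · exact Finset.prod_pos fun k _ => by
      have := pow_lt_one₀ h0.le hq (show 2*k+1 ≠ 0 by omega); linarith
  · apply Finset.prod_le_prod
    · intro k _
      have := pow_lt_one₀ h0.le hq (show 2*k+1 ≠ 0 by omega); linarith
    · intro k _
      have := norm_sub_norm_le (1:ℂ) (q^(2*k+1))
      simpa using this
end

open Complex Real Filter Topology
noncomputable section

/-! ### Part III: generating function -/

/-- `V(w;q)` -/
def VV (w q : ℂ) : ℂ := ∑' k : ℕ, q^k * PP w q k

/-- the coefficients of `V` -/
def coefOB (w : ℂ) (n : ℕ) : ℂ := ∑' d : {d : OBData // szOB d = n}, w ^ (rkOB d.1)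

lemma summable_r (r : ℝ) (h0 : 0 < r) (h1 : r < 1) : Summable (fun d : OBData => r ^ szOB d) := by
  rw [summable_sigma_of_nonneg (fun d => by positivity)]
  have hf := fun k => hasSum_fixed (1:ℝ) r one_ne_zero (by rwa [Real.norm_of_nonneg h0.le]) k
  simp only [one_zpow, one_mul] at hf
  refine ⟨fun k => (hf k).summable, ?_⟩
  simp_rw [fun k => (hf k).tsum_eq]
  refine Summable.of_nonneg_of_le (fun k => ?_) (fun k => ?_)
    ((summable_geometric_of_lt_one h0.le h1).mul_right (PR r))
  · have := PP_pos r h0 h1 k; positivity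
  · have := PP_le r h0 h1 k; gcongr

instance finite_fiber (n : ℕ) : Finite {d : OBData // szOB d = n} := by
  by_contra h
  rw [not_finite_iff_infinite] at h
  have h1 := (summable_r (1/2) (by norm_num) (by norm_num)).subtype {d | szOB d = n}
  have h2 : Summable (fun _ : {d : OBData // szOB d = n} => (1/2:ℝ)^n) :=
    h1.congr fun d => by
      have : szOB d.1 = n := d.2
      simp [this]
  rw [summable_const_iff] at h2
  exact absurd h2 (by positivity)

lemma summable_w (w q : ℂ) (hw : ‖w‖ = 1) (h0 : 0 < ‖q‖) (hq : ‖q‖ < 1) :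
    Summable (fun d : OBData => w ^ rkOB d * q ^ szOB d) := by
  refine Summable.of_norm ?_
  refine (summable_r ‖q‖ h0 hq).congr fun d => ?_
  simp [hw]

lemma coef_hasSum (w q : ℂ) (hw : ‖w‖ = 1) (h0 : 0 < ‖q‖) (hq : ‖q‖ < 1) :
    HasSum (fun n => coefOB w n * q^n) (VV w q) := by
  have hw0 : w ≠ 0 := by rintro rfl; simp at hw
  have hs := summable_w w q hw h0 hq
  have h1 := hs.hasSum.sigma (fun k => hasSum_fixed w q hw0 hq k)
  have h2 : VV w q = ∑' d : OBData, w ^ rkOB d * q ^ szOB d := h1.tsum_eq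
  rw [h2]
  have h3 := (Equiv.sigmaFiberEquiv szOB).hasSum_iff.2 hs.hasSum
  refine h3.sigma fun n => ?_
  have h4 : HasSum (fun d : {d : OBData // szOB d = n} => w ^ rkOB d.1 * q^n) (coefOB w n * q^n) :=
    (Summable.of_finite.hasSum).mul_right _
  refine h4.congr_fun fun d => ?_
  have : szOB d.1 = n := d.2
  simp [Equiv.sigmaFiberEquiv, this]

lemma countMod_eq (a : ℤ) (c : ℕ) (hc : 1 < c) (n : ℕ) :
    (c : ℂ) * (oddBalancedCountMod a c n : ℂ) = ∑ j ∈ Finset.range c,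
      (cexp (2 * π * I / c)) ^ (-a * j) * coefOB (cexp (2 * π * I / c) ^ j) n := by
  classical
  have hζ := Complex.isPrimitiveRoot_exp c (by omega)
  set ζ := cexp (2 * π * I / c)
  have hζ0 : ζ ≠ 0 := Complex.exp_ne_zero _
  haveI := Fintype.ofFinite {d : OBData // szOB d = n}
  have horth : ∀ m : ℤ, ∑ j ∈ Finset.range c, (ζ ^ m)^j = if (c:ℤ) ∣ m then (c:ℂ) else 0 := by
    intro m
    split_ifs with h
    · rw [(hζ.zpow_eq_one_iff_dvd m).2 h]; simp
    · have h1 : ζ^m ≠ 1 := fun h' => h ((hζ.zpow_eq_one_iff_dvd m).1 h')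
      rw [geom_sum_eq h1]
      have : (ζ^m)^c = 1 := by
        rw [← zpow_natCast, ← zpow_mul, mul_comm, zpow_mul, zpow_natCast, hζ.pow_eq_one, one_zpow]
      simp [this]
  have h1 : ∀ j ∈ Finset.range c, ζ ^ (-a * j) * coefOB (ζ^j) n =
      ∑ d : {d : OBData // szOB d = n}, (ζ ^ (rkOB d.1 - a)) ^ j := by
    intro j _
    rw [coefOB, tsum_fintype, Finset.mul_sum]
    refine Finset.sum_congr rfl fun d _ => ?_
    rw [← zpow_natCast, ← zpow_natCast, ← zpow_mul, ← zpow_mul, ← zpow_add₀ hζ0]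
    congr 1; ring
  rw [Finset.sum_congr rfl h1, Finset.sum_comm]
  simp_rw [horth]
  rw [← Finset.sum_filter, Finset.sum_const, nsmul_eq_mul, mul_comm]
  congr 2
  rw [oddBalancedCountMod_eq, ← Fintype.card_subtype, ← Nat.card_eq_fintype_card]
  refine Nat.card_congr ((Equiv.subtypeSubtypeEquivSubtypeInter _ _).symm.trans
    (Equiv.subtypeEquivRight fun d => ?_))
  rw [Int.modEq_comm]
  exact Int.modEq_iff_dvd

lemma integral_exp_int (k : ℤ) : ∫ θ in (-π)..π, cexp (I * k * θ) = if k = 0 then 2 * (π:ℂ) else 0 := by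
  split_ifs with h
  · subst h; simp; ring
  · have : (I * k : ℂ) ≠ 0 := by simp [h]
    rw [integral_exp_mul_complex this, div_eq_zero_iff]
    left
    rw [sub_eq_zero, Complex.exp_eq_exp_iff_exists_int]
    exact ⟨k, by push_cast; ring⟩

lemma cauchy_coef (w : ℂ) (hw : ‖w‖ = 1) (t : ℝ) (ht : 0 < t) (n : ℕ) :
    coefOB w n = (1 / (2 * π)) * ∫ θ in (-π)..π, VV w (cexp (-(t + I * θ))) * cexp (n * (t + I * θ)) := by
  have hnorm : ∀ θ : ℝ, ‖cexp (-(t + I * θ))‖ = Real.exp (-t) := by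
    intro θ; rw [Complex.norm_exp]; simp
  have hlt : Real.exp (-t) < 1 := by rw [Real.exp_lt_one_iff]; linarith
  have hb : ∀ (m : ℕ) (θ : ℝ), ‖coefOB w m * cexp (-(t + I * θ))^m * cexp (n * (t + I * θ))‖ =
      ‖coefOB w m * ((Real.exp (-t) : ℝ) : ℂ)^m‖ * Real.exp (n * t) := by
    intro m θ
    rw [norm_mul, norm_mul, norm_mul, norm_pow, norm_pow, hnorm, Complex.norm_real,
      Real.norm_of_nonneg (Real.exp_pos _).le, Complex.norm_exp]
    simp
  have hsum : Summable (fun m => ‖coefOB w m * ((Real.exp (-t) : ℝ) : ℂ)^m‖ * Real.exp (n * t)) := by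
    refine Summable.mul_right _ ?_
    refine (coef_hasSum w _ hw ?_ ?_).summable.norm
    · rw [Complex.norm_real, Real.norm_of_nonneg (Real.exp_pos _).le]; exact Real.exp_pos _
    · rw [Complex.norm_real, Real.norm_of_nonneg (Real.exp_pos _).le]; exact hlt
  have key := intervalIntegral.hasSum_integral_of_dominated_convergence
    (μ := MeasureTheory.volume) (a := -π) (b := π)
    (F := fun (m : ℕ) (θ : ℝ) => coefOB w m * cexp (-(t + I * θ))^m * cexp (n * (t + I * θ)))
    (f := fun θ : ℝ => VV w (cexp (-(t + I * θ))) * cexp (n * (t + I * θ)))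
    (fun m _ => ‖coefOB w m * ((Real.exp (-t) : ℝ) : ℂ)^m‖ * Real.exp (n * t))
    (fun m => (by fun_prop : Continuous _).aestronglyMeasurable)
    (fun m => .of_forall fun θ _ => (hb m θ).le)
    (.of_forall fun θ _ => hsum)
    (by simp)
    (.of_forall fun θ _ => (coef_hasSum w _ hw (by rw [hnorm]; exact Real.exp_pos _)
      (by rw [hnorm]; exact hlt)).mul_right _)
  have hterm : ∀ m : ℕ, (∫ θ in (-π)..π, coefOB w m * cexp (-(t + I * θ))^m * cexp (n * (t + I * θ)))
      = if m = n then coefOB w n * (2 * π) else 0 := by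
    intro m
    have : ∀ θ : ℝ, coefOB w m * cexp (-(t + I * θ))^m * cexp (n * (t + I * θ)) =
        coefOB w m * cexp ((n - m) * t) * cexp (I * ((n:ℤ) - (m:ℤ) : ℤ) * θ) := by
      intro θ
      rw [← Complex.exp_nat_mul, mul_assoc, mul_assoc, ← Complex.exp_add, ← Complex.exp_add]
      congr 2
      push_cast; ring
    simp_rw [this]
    rw [intervalIntegral.integral_const_mul, integral_exp_int]
    by_cases h : m = n
    · subst h; simp
    · rw [if_neg h, if_neg (by omega), mul_zero]
  simp_rw [hterm] at key
  have h5 := hasSum_ite_eq n (coefOB w n * (2 * (π:ℂ)))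
  rw [key.unique h5]
  have : (π:ℂ) ≠ 0 := by exact_mod_cast Real.pi_ne_zero
  field_simp
end

open Complex Real Filter Topology
noncomputable section

/-! ### Part IV: bounds -/

lemma er_lt {t : ℝ} (ht : 0 < t) : Real.exp (-t) < 1 := by rw [Real.exp_lt_one_iff]; linarith

lemma PP_step (r : ℝ) (h0 : 0 < r) (h1 : r < 1) (n : ℕ) :
    PP (1:ℝ) r n * (1 + 2 * r^(n+1)) ≤ PP (1:ℝ) r (n+1) := by
  have h := PP_succ r (by rwa [Real.norm_of_nonneg h0.le]) n
  have hp := PP_pos r h0 h1 n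
  have h3 : 0 < 1 - r^(2*n+3) := by
    have := pow_lt_one₀ h0.le h1 (show 2*n+3 ≠ 0 by omega); linarith
  have : 0 ≤ PP 1 r n * ((r^(2*n+2) + r^(2*n+3) + 2 * r^(3*n+4)) / (1 - r^(2*n+3))) := by
    positivity
  linarith

lemma PP_growth (r : ℝ) (h0 : 0 < r) (h1 : r < 1) (N M : ℕ) :
    PP (1:ℝ) r N * (1 + 2 * r^(N+M))^M ≤ PR r := by
  have key : ∀ m ≤ M, PP (1:ℝ) r N * (1 + 2 * r^(N+M))^m ≤ PP (1:ℝ) r (N+m) := by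
    intro m hm
    induction m with
    | zero => simp
    | succ m ih =>
      have h2 := ih (by omega)
      have h3 := PP_step r h0 h1 (N+m)
      have h4 : r^(N+M) ≤ r^(N+m+1) := pow_le_pow_of_le_one h0.le h1.le (by omega)
      have h5 := PP_pos r h0 h1 (N+m)
      calc PP (1:ℝ) r N * (1 + 2 * r^(N+M))^(m+1)
          = (PP (1:ℝ) r N * (1 + 2 * r^(N+M))^m) * (1 + 2 * r^(N+M)) := by ring
        _ ≤ PP (1:ℝ) r (N+m) * (1 + 2 * r^(N+m+1)) := by gcongr
        _ ≤ _ := h3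
  exact (key M le_rfl).trans (PP_le r h0 h1 _)

lemma exp_pow_ge {t : ℝ} (_ht : 0 < t) {m : ℕ} {K : ℝ} (h : m * t ≤ K) :
    Real.exp (-K) ≤ Real.exp (-t) ^ m := by
  rw [← Real.exp_nat_mul]
  apply Real.exp_le_exp.2; linarith

/-- constant -/
def del1 : ℝ := Real.log (1 + 2 * Real.exp (-2)) / 2

lemma del1_pos : 0 < del1 := by
  unfold del1
  have : 0 < Real.log (1 + 2 * Real.exp (-2)) := Real.log_pos (by linarith [Real.exp_pos (-2)])
  linarith

lemma floor_facts {t : ℝ} (ht : 0 < t) (ht2 : t ≤ 1/2) :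
    1 / (2 * t) ≤ (⌊1/t⌋₊ : ℝ) ∧ (⌊1/t⌋₊ : ℝ) * t ≤ 1 := by
  have h1 := Nat.floor_le (show 0 ≤ 1/t by positivity)
  have h2 := Nat.lt_floor_add_one (1/t)
  constructor
  · have : 1 ≤ 1/(2*t) := by rw [le_div_iff₀ (by positivity)]; linarith
    have e : 1/t = 1/(2*t) + 1/(2*t) := by field_simp; norm_num
    linarith
  · calc (⌊1/t⌋₊ : ℝ) * t ≤ 1/t * t := by gcongr
      _ = 1 := by field_simp

lemma PP_early {t : ℝ} (ht : 0 < t) (ht2 : t ≤ 1/2) (n : ℕ) (hn : n ≤ ⌊1/t⌋₊) :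
    PP (1:ℝ) (Real.exp (-t)) n ≤ Real.exp (-del1 / t) * PR (Real.exp (-t)) := by
  obtain ⟨f1, f2⟩ := floor_facts ht ht2
  set N := ⌊1/t⌋₊
  have h0 := Real.exp_pos (-t)
  have h1 := er_lt ht
  have h2 := PP_growth _ h0 h1 N N
  have h3 : Real.exp (-2) ≤ Real.exp (-t) ^ (N+N) := exp_pow_ge ht (by push_cast; linarith)
  have h4 : Real.exp (del1 / t) ≤ (1 + 2 * Real.exp (-t) ^ (N+N))^N := by
    calc Real.exp (del1 / t) ≤ Real.exp (N * Real.log (1 + 2 * Real.exp (-2))) := by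
          apply Real.exp_le_exp.2
          have : del1 / t = 1/(2*t) * Real.log (1 + 2 * Real.exp (-2)) := by
            unfold del1; field_simp
          rw [this]
          have : 0 ≤ Real.log (1 + 2 * Real.exp (-2)) := Real.log_nonneg (by linarith [Real.exp_pos (-2)])
          gcongr
      _ = (1 + 2 * Real.exp (-2))^N := by
          rw [Real.exp_nat_mul, Real.exp_log (by positivity)]
      _ ≤ _ := by gcongr
  have h5 := PP_pos _ h0 h1 N
  have h6 : PP (1:ℝ) (Real.exp (-t)) N * Real.exp (del1/t) ≤ PR (Real.exp (-t)) := by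
    refine le_trans ?_ h2; gcongr
  have h7 : Real.exp (-del1/t) * Real.exp (del1/t) = 1 := by
    rw [← Real.exp_add]; simp [neg_div]
  calc _ ≤ PP (1:ℝ) (Real.exp (-t)) N := PP_mono _ h0 h1 hn
    _ = Real.exp (-del1/t) * (PP (1:ℝ) (Real.exp (-t)) N * Real.exp (del1/t)) := by
        rw [mul_comm (PP _ _ _), ← mul_assoc, h7, one_mul]
    _ ≤ _ := by gcongr

lemma PP_late_w (w q : ℂ) (hw : ‖w‖ = 1) (h0 : 0 < ‖q‖) (hq : ‖q‖ < 1) (κ : ℝ) (hκ : |w.re| ≤ κ)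
    (hκ1 : κ < 1) (y : ℝ) (hy0 : 0 ≤ y) (N n : ℕ) (hNn : N ≤ n) (hy : y ≤ ‖q‖^N) :
    ‖PP w q n‖ ≤ (1 - (1 - κ) * y / 2)^N * PP (1:ℝ) ‖q‖ n := by
  have hκ0 : 0 ≤ κ := (abs_nonneg _).trans hκ
  have hwi : w⁻¹ = (starRingEnd ℂ) w := by
    rw [Complex.inv_def, Complex.normSq_eq_norm_sq, hw]; simp
  have hy1 : y ≤ 1 := hy.trans (pow_le_one₀ h0.le hq.le)
  have hfac : ∀ k, ‖(1 + w * q^(k+1)) * (1 + w⁻¹ * q^(k+1))‖ ≤ 1 + 2 * κ * ‖q‖^(k+1) + (‖q‖^(k+1))^2 := by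
    intro k
    have e : (1 + w * q^(k+1)) * (1 + w⁻¹ * q^(k+1)) = 1 + ((2 * w.re : ℝ) : ℂ) * q^(k+1) + (q^(k+1))^2 := by
      have h1 : w * w⁻¹ = 1 := mul_inv_cancel₀ (by rintro rfl; simp at hw)
      have h2 : w + w⁻¹ = ((2 * w.re : ℝ) : ℂ) := by rw [hwi, Complex.add_conj]
      rw [← h2]
      linear_combination (q^(k+1))^2 * h1
    rw [e]
    refine (norm_add₃_le).trans ?_
    simp only [norm_mul, Complex.norm_real, Real.norm_eq_abs, abs_mul, norm_one, norm_pow, abs_two]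
    gcongr
  have hfac2 : ∀ k, 1 + 2 * κ * ‖q‖^(k+1) + (‖q‖^(k+1))^2 ≤ (1 + ‖q‖^(k+1))*(1 + ‖q‖^(k+1)) := by
    intro k
    have : 0 < ‖q‖^(k+1) := by positivity
    nlinarith
  have hfac3 : ∀ k < N, 1 + 2 * κ * ‖q‖^(k+1) + (‖q‖^(k+1))^2 ≤
      (1 - (1 - κ) * y / 2) * ((1 + ‖q‖^(k+1))*(1 + ‖q‖^(k+1))) := by
    intro k hk
    have a1 : y ≤ ‖q‖^(k+1) := hy.trans (pow_le_pow_of_le_one h0.le hq.le (by omega))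
    have a2 : ‖q‖^(k+1) ≤ 1 := pow_le_one₀ h0.le hq.le
    set u := ‖q‖^(k+1)
    have a3 : (1 + u) * (1+u) ≤ 4 := by nlinarith
    have a4 : 0 ≤ (1 - κ) * y := by apply mul_nonneg <;> linarith
    have a5 : (1-κ) * y / 2 * ((1 + u) * (1+u)) ≤ (1-κ) * y / 2 * 4 := by gcongr
    have a6 : (1-κ) * y ≤ (1-κ) * u := by
      apply mul_le_mul_of_nonneg_left a1; linarith
    nlinarith
  have hc0 : 0 ≤ 1 - (1 - κ) * y / 2 := by nlinarith
  rw [PP, PP, norm_div, norm_prod, norm_prod, ← mul_div_assoc]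
  have hdpos : ∀ k, 0 < 1 - ‖q‖^(2*k+1) := fun k => by
    have := pow_lt_one₀ h0.le hq (show 2*k+1 ≠ 0 by omega); linarith
  apply div_le_div₀
  · apply mul_nonneg (pow_nonneg hc0 _)
    exact Finset.prod_nonneg fun k _ => by simp; positivity
  · rw [← Finset.prod_range_mul_prod_Ico _ hNn, ← Finset.prod_range_mul_prod_Ico _ hNn, ← mul_assoc]
    simp only [one_mul, inv_one]
    apply mul_le_mul
    · have : (1 - (1 - κ) * y / 2)^N = ∏ k ∈ Finset.range N, (1 - (1 - κ) * y / 2) := by simp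
      rw [this, ← Finset.prod_mul_distrib]
      apply Finset.prod_le_prod
      · intros; positivity
      · intro k hk
        exact (hfac k).trans (hfac3 k (Finset.mem_range.1 hk))
    · apply Finset.prod_le_prod
      · intros; positivity
      · intro k hk
        exact (hfac k).trans (hfac2 k)
    · positivity
    · apply mul_nonneg (pow_nonneg hc0 _); positivity
  · exact Finset.prod_pos fun k _ => hdpos k
  · apply Finset.prod_le_prod
    · intro k _; exact (hdpos k).le
    · intro k _
      have := norm_sub_norm_le (1:ℂ) (q^(2*k+1))
      simpa using this

/-- bound for `V(w;q)`, `w ≠ ±1` -/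
lemma VV_w_bound (w : ℂ) (hw : ‖w‖ = 1) (hre : |w.re| < 1) : ∃ δ > 0, ∀ t : ℝ, 0 < t → t ≤ 1/2 →
    ∀ q : ℂ, ‖q‖ = Real.exp (-t) →
    ‖VV w q‖ ≤ Real.exp (-δ / t) * PR (Real.exp (-t)) / (1 - Real.exp (-t)) := by
  set ρ := 1 - (1 - |w.re|) * Real.exp (-1) / 2 with hρ
  have he1 : Real.exp (-1) < 1 := by rw [Real.exp_lt_one_iff]; norm_num
  have he0 := Real.exp_pos (-1)
  have hρ1 : ρ < 1 := by
    have : 0 < (1 - |w.re|) * Real.exp (-1) := mul_pos (by linarith) he0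
    linarith
  have hρ0 : 0 < ρ := by
    have : (1 - |w.re|) * Real.exp (-1) < 2 := by nlinarith [abs_nonneg w.re]
    linarith
  have hlog : 0 < -Real.log ρ := by linarith [Real.log_neg hρ0 hρ1]
  refine ⟨min del1 (-Real.log ρ / 2), lt_min del1_pos (by linarith), ?_⟩
  intro t ht ht2 q hq
  obtain ⟨f1, f2⟩ := floor_facts ht ht2
  have h0 := Real.exp_pos (-t)
  have h1 := er_lt ht
  set δ := min del1 (-Real.log ρ / 2)
  have hPR : 0 ≤ PR (Real.exp (-t)) := norm_nonneg _
  have hb : ∀ n, ‖PP w q n‖ ≤ Real.exp (-δ/t) * PR (Real.exp (-t)) := by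
    intro n
    rcases le_total n ⌊1/t⌋₊ with hn | hn
    · refine (PP_norm_le w q hw (by rw [hq]; exact h0) (by rw [hq]; exact h1) n).trans ?_
      rw [hq]
      refine (PP_early ht ht2 n hn).trans ?_
      have : δ ≤ del1 := min_le_left _ _
      gcongr
    · have := PP_late_w w q hw (by rw [hq]; exact h0) (by rw [hq]; exact h1) _ le_rfl hre
        (Real.exp (-1)) he0.le ⌊1/t⌋₊ n hn (by rw [hq]; exact exp_pow_ge ht f2)
      refine this.trans ?_
      rw [hq]
      have g1 : ρ ^ ⌊1/t⌋₊ ≤ Real.exp (-δ/t) := by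
        rw [← Real.exp_log hρ0, ← Real.exp_nat_mul]
        apply Real.exp_le_exp.2
        have a1 : δ ≤ -Real.log ρ / 2 := min_le_right _ _
        have a2 : δ / t ≤ 1/(2*t) * (-Real.log ρ) := by
          calc δ / t ≤ (-Real.log ρ / 2) / t := by gcongr
            _ = _ := by field_simp
        have a3 : 1/(2*t) * (-Real.log ρ) ≤ ⌊1/t⌋₊ * (-Real.log ρ) := by gcongr
        rw [neg_div]; linarith
      have g2 := PP_le _ h0 h1 n
      have g3 := (PP_pos _ h0 h1 n).le
      gcongr
  have hs : Summable (fun k : ℕ => Real.exp (-t)^k * (Real.exp (-δ/t) * PR (Real.exp (-t)))) :=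
    (summable_geometric_of_lt_one h0.le h1).mul_right _
  have hle : ∀ k, ‖q^k * PP w q k‖ ≤ Real.exp (-t)^k * (Real.exp (-δ/t) * PR (Real.exp (-t))) := by
    intro k
    rw [norm_mul, norm_pow, hq]
    have := hb k
    gcongr
  refine (tsum_of_norm_bounded hs.hasSum hle).trans (le_of_eq ?_)
  rw [tsum_mul_right, tsum_geometric_of_lt_one h0.le h1]
  field_simp
end

open Complex Real Filter Topology
noncomputable section

/-! ### Part V: minor arc bounds for `w = 1` -/

lemma cos_sum (θ : ℝ) (J : ℕ) :
    2 * Real.sin θ * ∑ j ∈ Finset.range J, Real.cos ((2*j+1)*θ) = Real.sin (2*J*θ) := by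
  induction J with
  | zero => simp
  | succ J ih =>
    rw [Finset.sum_range_succ, mul_add, ih]
    push_cast
    rw [show 2 * ((J:ℝ)+1) * θ = (2*J+1)*θ + θ by ring, show 2 * (J:ℝ) * θ = (2*J+1)*θ - θ by ring,
      Real.sin_add, Real.sin_sub]
    ring

lemma cos_sum_abs {t θ : ℝ} (ht : 0 < t) (h1 : π * t ≤ θ) (h2 : θ ≤ π/2) (J : ℕ) :
    |∑ j ∈ Finset.range J, Real.cos ((2*j+1)*θ)| ≤ 1 / (4*t) := by
  have hpi := Real.pi_pos
  have hθ : 0 ≤ θ := le_trans (by positivity) h1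
  have hs : 2 * t ≤ Real.sin θ := by
    have := Real.mul_le_sin hθ h2
    refine le_trans ?_ this
    rw [div_mul_eq_mul_div, le_div_iff₀ hpi]; linarith
  have h3 := cos_sum θ J
  set C := ∑ j ∈ Finset.range J, Real.cos ((2*j+1)*θ)
  have h4 : |2 * Real.sin θ * C| ≤ 1 := by rw [h3]; exact Real.abs_sin_le_one _
  rw [abs_mul, abs_of_pos (by linarith : 0 < 2 * Real.sin θ)] at h4
  rw [le_div_iff₀ (by positivity)]
  have := abs_nonneg C
  nlinarith

lemma cos_sum_le {t θ : ℝ} (ht : 0 < t) (ht2 : t ≤ 1/8) (h1 : π * t ≤ θ) (h2 : θ ≤ π) :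
    ∑ j ∈ Finset.range ⌊1/(2*t)⌋₊, Real.cos ((2*j+1)*θ) ≤ 3/4 * ⌊1/(2*t)⌋₊ := by
  have hpi := Real.pi_pos
  have f1 := Nat.floor_le (show 0 ≤ 1/(2*t) by positivity)
  have f2 := Nat.lt_floor_add_one (1/(2*t))
  set J := ⌊1/(2*t)⌋₊
  have hJ : 1/(4*t) ≤ 3/4 * (J:ℝ) := by
    have e : 1/(2*t) = 2 * (1/(4*t)) := by field_simp; norm_num
    have : 2 ≤ 1/(4*t) := by rw [le_div_iff₀ (by positivity)]; linarith
    linarith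
  rcases le_total θ (π/2) with h | h
  · exact (le_abs_self _).trans ((cos_sum_abs ht h1 h J).trans hJ)
  · obtain ⟨η, rfl⟩ : ∃ η, θ = π - η := ⟨π - θ, by ring⟩
    have e : ∀ j : ℕ, Real.cos ((2*j+1)*(π - η)) = - Real.cos ((2*j+1)*η) := by
      intro j
      rw [show (2*(j:ℝ)+1)*(π - η) = (π - (2*j+1)*η) + j * (2*π) by ring,
        Real.cos_add_nat_mul_two_pi, Real.cos_pi_sub]
    simp_rw [e, Finset.sum_neg_distrib]
    rcases le_total (π * t) η with h3 | h3
    · exact (neg_le_abs _).trans ((cos_sum_abs ht h3 (by linarith) J).trans hJ)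
    · have hη : 0 ≤ η := by linarith
      have h4 := cos_sum η J
      have h5 : 0 ≤ Real.sin (2 * J * η) := by
        apply Real.sin_nonneg_of_nonneg_of_le_pi
        · positivity
        · calc 2 * J * η ≤ 2 * (1/(2*t)) * (π * t) := by gcongr
            _ = π := by field_simp
      have h6 : 0 ≤ ∑ j ∈ Finset.range J, Real.cos ((2*j+1)*η) := by
        rcases hη.eq_or_lt with h | h
        · subst h; simp
        · have hs : 0 < Real.sin η := Real.sin_pos_of_pos_of_lt_pi h (by linarith)
          by_contra hneg
          push Not at hneg
          have : 2 * Real.sin η * ∑ j ∈ Finset.range J, Real.cos ((2*j+1)*η) < 0 :=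
            mul_neg_of_pos_of_neg (by positivity) hneg
          linarith
      have : (0:ℝ) ≤ J := by positivity
      linarith

lemma sin_sum_ge {t θ : ℝ} (ht : 0 < t) (ht2 : t ≤ 1/8) (h1 : π * t ≤ |θ|) (h2 : |θ| ≤ π) :
    (⌊1/(2*t)⌋₊ : ℝ) / 8 ≤ ∑ j ∈ Finset.range ⌊1/(2*t)⌋₊, Real.sin ((2*j+1)*θ/2)^2 := by
  have h := cos_sum_le ht ht2 h1 h2
  have e : ∀ j : ℕ, Real.sin ((2*j+1)*θ/2)^2 = 1/2 - Real.cos ((2*j+1)*|θ|)/2 := by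
    intro j
    rw [Real.sin_sq_eq_half_sub, show 2 * ((2*(j:ℝ)+1)*θ/2) = (2*j+1)*θ by ring]
    congr 2
    rcases abs_choice θ with h | h <;> rw [h]
    rw [mul_neg, Real.cos_neg]
  simp_rw [e]
  rw [Finset.sum_sub_distrib, ← Finset.sum_div, ← Finset.sum_div]
  simp only [Finset.sum_const, Finset.card_range, nsmul_eq_mul]
  linarith

/-- single factor -/
lemma factor_bound {t θ : ℝ} (ht : 0 < t) (m : ℕ) (hm0 : 0 < m) (hm : m * t ≤ 1) (s : ℝ) (hs0 : 0 ≤ s)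
    (hs1 : s ≤ 1) (hs : s * (m*t)^2 ≤ Real.sin (m*θ/2)^2) :
    (1 - Real.exp (-t)^m) ≤ Real.exp (-s/4) * ‖1 - cexp (-(t + I * θ))^m‖ := by
  have hr : Real.exp (-t)^m = Real.exp (-(m*t)) := by rw [← Real.exp_nat_mul]; ring_nf
  have hq : cexp (-(t + I * θ))^m = (Real.exp (-(m*t)) : ℝ) * cexp ((-(m*θ) : ℝ) * I) := by
    rw [← Complex.exp_nat_mul, Complex.ofReal_exp, ← Complex.exp_add]
    congr 1; push_cast; ring
  have hn : ‖1 - cexp (-(t + I * θ))^m‖^2 =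
      (1 - Real.exp (-(m*t)))^2 + 4 * Real.exp (-(m*t)) * Real.sin (m*θ/2)^2 := by
    rw [hq, Complex.exp_mul_I, ← Complex.ofReal_cos, ← Complex.ofReal_sin, ← Complex.normSq_eq_norm_sq,
      Complex.normSq_apply, Real.sin_sq_eq_half_sub (m*θ/2), show 2 * (m*θ/2) = m*θ by ring]
    have := Real.sin_sq_add_cos_sq (m*θ)
    rw [Real.cos_neg, Real.sin_neg]
    generalize Real.exp (-(m*t)) = ρ at *
    generalize Real.cos (m*θ) = u at *
    generalize Real.sin (m*θ) = v at *
    simp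
    linear_combination ρ^2 * this
  rw [hr]
  set ρ := Real.exp (-(m*t))
  have hρ1 : Real.exp (-1) ≤ ρ := Real.exp_le_exp.2 (by linarith)
  have he : 1/4 ≤ Real.exp (-1) := by
    rw [Real.exp_neg, one_div]
    gcongr
    have := Real.exp_one_lt_d9; linarith
  have hρlt : ρ < 1 := by
    rw [Real.exp_lt_one_iff]
    have : 0 < (m:ℝ) * t := by positivity
    linarith
  have h1 : 1 - ρ ≤ m * t := by have := Real.add_one_le_exp (-(m*t)); linarith
  have h2 : s * (1-ρ)^2 ≤ Real.sin (m*θ/2)^2 := by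
    refine le_trans ?_ hs
    have : 0 ≤ 1 - ρ := by linarith
    gcongr
  have h3 : (1 + s) * (1-ρ)^2 ≤ ‖1 - cexp (-(t + I * θ))^m‖^2 := by
    rw [hn]
    have : Real.sin (m*θ/2)^2 ≤ 4 * ρ * Real.sin (m*θ/2)^2 := by
      have : 1 ≤ 4 * ρ := by linarith
      nlinarith [sq_nonneg (Real.sin (m*θ/2))]
    linarith
  have h4 : Real.exp (s/2) ≤ 1 + s := by
    have a := Real.one_sub_le_exp_neg (s/2)
    rw [Real.exp_neg] at a
    have b := Real.exp_pos (s/2)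
    have c : (1 - s/2) * Real.exp (s/2) ≤ 1 := by
      calc _ ≤ (Real.exp (s/2))⁻¹ * Real.exp (s/2) := by gcongr
        _ = 1 := by field_simp
    have d : (1 - s/2) * Real.exp (s/2) ≤ (1 - s/2) * (1 + s) := by nlinarith
    exact le_of_mul_le_mul_left d (by linarith)
  have h5 : (1-ρ)^2 ≤ (Real.exp (-s/4) * ‖1 - cexp (-(t + I * θ))^m‖)^2 := by
    rw [mul_pow, ← Real.exp_nat_mul]
    have a : Real.exp ((2:ℕ) * (-s/4)) * Real.exp (s/2) = 1 := by
      rw [← Real.exp_add]; convert Real.exp_zero using 2; push_cast; ring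
    calc (1-ρ)^2 = Real.exp ((2:ℕ) * (-s/4)) * (Real.exp (s/2) * (1-ρ)^2) := by
          rw [← mul_assoc, a, one_mul]
      _ ≤ Real.exp ((2:ℕ) * (-s/4)) * ((1+s) * (1-ρ)^2) := by gcongr
      _ ≤ _ := by gcongr
  exact le_of_sq_le_sq h5 (by positivity)

lemma PP_gain {t θ : ℝ} (ht : 0 < t) (s : ℕ → ℝ) (J n : ℕ) (hJn : J ≤ n + 1)
    (hJ : 2 * (J:ℝ) * t ≤ 1) (hs0 : ∀ j < J, 0 ≤ s j) (hs1 : ∀ j < J, s j ≤ 1)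
    (hs : ∀ j < J, s j * ((2*j+1)*t)^2 ≤ Real.sin ((2*j+1)*θ/2)^2) :
    ‖PP 1 (cexp (-(t + I * θ))) n‖ ≤
      Real.exp (-(∑ j ∈ Finset.range J, s j)/4) * PP (1:ℝ) (Real.exp (-t)) n := by
  have hnorm : ‖cexp (-(t + I * θ))‖ = Real.exp (-t) := by
    rw [Complex.norm_exp]; simp
  have h0 := Real.exp_pos (-t)
  have h1 := er_lt ht
  set q := cexp (-(t + I * θ))
  set r := Real.exp (-t)
  have hd : ∀ k, 0 < 1 - r^(2*k+1) := fun k => by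
    have := pow_lt_one₀ h0.le h1 (show 2*k+1 ≠ 0 by omega); linarith
  have hd2 : ∀ k, 1 - r^(2*k+1) ≤ ‖1 - q^(2*k+1)‖ := fun k => by
      have := norm_sub_norm_le (1:ℂ) (q^(2*k+1))
      simpa [hnorm] using this
  rw [PP, PP, norm_div, norm_prod, norm_prod, ← mul_div_assoc]
  have hD : (∏ k ∈ Finset.range (n+1), (1 - r^(2*k+1))) ≤ Real.exp (-(∑ j ∈ Finset.range J, s j)/4) *
      ∏ k ∈ Finset.range (n+1), ‖1 - q^(2*k+1)‖ := by
    rw [← Finset.prod_range_mul_prod_Ico _ hJn, ← Finset.prod_range_mul_prod_Ico _ hJn, ← mul_assoc]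
    apply mul_le_mul
    · have : Real.exp (-(∑ j ∈ Finset.range J, s j)/4) = ∏ j ∈ Finset.range J, Real.exp (-s j/4) := by
        rw [← Real.exp_sum, ← Finset.sum_neg_distrib, Finset.sum_div]
      rw [this, ← Finset.prod_mul_distrib]
      apply Finset.prod_le_prod
      · intro k _; exact (hd k).le
      · intro j hj
        have hj := Finset.mem_range.1 hj
        apply factor_bound ht _ (by omega) _ (s j) (hs0 j hj) (hs1 j hj)
        · push_cast; exact hs j hj
        · push_cast
          refine le_trans ?_ hJ
          have : (j:ℝ) + 1 ≤ J := by exact_mod_cast hj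
          gcongr
          linarith
    · apply Finset.prod_le_prod
      · intro k _; exact (hd k).le
      · intro k _; exact hd2 k
    · exact Finset.prod_nonneg fun k _ => (hd k).le
    · positivity
  have hN : ∏ k ∈ Finset.range n, ‖(1 + 1 * q^(k+1)) * (1 + 1⁻¹ * q^(k+1))‖ ≤
      ∏ k ∈ Finset.range n, ((1 + 1 * r^(k+1)) * (1 + 1⁻¹ * r^(k+1))) := by
    apply Finset.prod_le_prod
    · intros; positivity
    · intro k _
      have hb : ‖1 + q^(k+1)‖ ≤ 1 + r^(k+1) := by
        refine (norm_add_le _ _).trans ?_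
        simp [hnorm]
      rw [norm_mul]
      simp only [one_mul, inv_one]
      gcongr
  have hDp : 0 < ∏ k ∈ Finset.range (n+1), (1 - r^(2*k+1)) := Finset.prod_pos fun k _ => hd k
  have hDp2 : 0 < ∏ k ∈ Finset.range (n+1), ‖1 - q^(2*k+1)‖ :=
    Finset.prod_pos fun k _ => (hd k).trans_le (hd2 k)
  rw [div_le_div_iff₀ hDp2 hDp]
  have hNn : 0 ≤ ∏ k ∈ Finset.range n, ((1 + 1 * r^(k+1)) * (1 + 1⁻¹ * r^(k+1))) :=
    Finset.prod_nonneg fun k _ => by simp; positivity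
  calc _ ≤ (∏ k ∈ Finset.range n, ((1 + 1 * r^(k+1)) * (1 + 1⁻¹ * r^(k+1)))) *
        (Real.exp (-(∑ j ∈ Finset.range J, s j)/4) * ∏ k ∈ Finset.range (n+1), ‖1 - q^(2*k+1)‖) := by
        apply mul_le_mul hN hD hDp.le hNn
    _ = _ := by ring

lemma exp_small (a : ℝ) (ha : 0 < a) {t : ℝ} (ht : 0 < t) : Real.exp (-a/t) ≤ 24 / a^4 * t^4 := by
  have h := Real.pow_div_factorial_le_exp (a/t) (by positivity) 4
  rw [neg_div, Real.exp_neg]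
  rw [inv_le_comm₀ (Real.exp_pos _) (by positivity)]
  refine le_trans (le_of_eq ?_) h
  simp [Nat.factorial]
  field_simp

lemma PP_late_one : ∃ C > 0, ∀ t θ : ℝ, 0 < t → t ≤ 1/8 → |θ| ≤ π → ∀ n : ℕ, ⌊1/t⌋₊ ≤ n →
    ‖PP 1 (cexp (-(t + I * θ))) n‖ ≤ C / (1 + θ^2/t^3) * PP (1:ℝ) (Real.exp (-t)) n := by
  have hpi := Real.pi_pos
  refine ⟨max (64*π^2) (24 * 128^4 * (1+π^2)), lt_max_of_lt_left (by positivity), ?_⟩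
  intro t θ ht ht2 hθ n hn
  have f1 := Nat.floor_le (show 0 ≤ 1/(2*t) by positivity)
  have f2 := Nat.lt_floor_add_one (1/(2*t))
  have hJn : ⌊1/(2*t)⌋₊ ≤ n + 1 := by
    refine le_trans (Nat.floor_le_floor ?_) (hn.trans (Nat.le_succ n))
    apply one_div_le_one_div_of_le ht; linarith
  have hpp := (PP_pos _ (Real.exp_pos (-t)) (er_lt ht) n).le
  set J := ⌊1/(2*t)⌋₊
  have hJ1 : 2 * (J:ℝ) * t ≤ 1 := by
    calc 2 * (J:ℝ) * t ≤ 2 * (1/(2*t)) * t := by gcongr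
      _ = 1 := by field_simp
  have hJ2 : 1/(4*t) ≤ (J:ℝ) := by
    have e : 1/(2*t) = 2 * (1/(4*t)) := by field_simp; norm_num
    have : 2 ≤ 1/(4*t) := by rw [le_div_iff₀ (by positivity)]; linarith
    linarith
  rcases le_total |θ| (π * t) with h | h
  · -- central
    have hs1 : (θ/(π*t))^2 ≤ 1 := by
      rw [div_pow, div_le_one (by positivity), ← sq_abs]
      gcongr
    have := PP_gain (θ := θ) ht (fun _ => (θ/(π*t))^2) J n hJn hJ1 (fun _ _ => by positivity) (fun _ _ => hs1)
      (by
        intro j hj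
        have hj1 : (2*(j:ℝ)+1) * t ≤ 1 := by
          refine le_trans ?_ hJ1
          have : (j:ℝ) + 1 ≤ J := by exact_mod_cast hj
          gcongr
          linarith
        have a : |(2*(j:ℝ)+1)*θ/2| ≤ π/2 := by
          rw [abs_div, abs_mul, abs_of_pos (by positivity : 0 < 2*(j:ℝ)+1), abs_two]
          have : (2*(j:ℝ)+1)*|θ| ≤ (2*(j:ℝ)+1)*(π*t) := by gcongr
          have : (2*(j:ℝ)+1)*(π*t) ≤ π := by nlinarith
          linarith
        have b := Real.mul_abs_le_abs_sin a
        rw [← sq_abs (Real.sin _)]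
        refine le_trans (le_of_eq ?_) (pow_le_pow_left₀ (by positivity) b 2)
        rw [mul_pow (2/π) _ 2, sq_abs]
        field_simp)
    refine this.trans ?_
    gcongr
    refine le_trans ?_ (div_le_div_of_nonneg_right (le_max_left _ _) (by positivity))
    simp only [Finset.sum_const, Finset.card_range, nsmul_eq_mul]
    set y := θ^2/t^3
    have hy : 0 ≤ y := by positivity
    have e1 : y/(16*π^2) ≤ (J:ℝ) * (θ/(π*t))^2/4 := by
      calc y/(16*π^2) = (1/(4*t)) * (θ/(π*t))^2/4 := by simp only [y]; field_simp; norm_num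
        _ ≤ _ := by gcongr
    have e2 := Real.add_one_le_exp ((J:ℝ) * (θ/(π*t))^2/4)
    rw [neg_div, Real.exp_neg, inv_le_comm₀ (Real.exp_pos _) (by positivity), inv_div]
    refine le_trans ?_ e2
    rw [div_le_iff₀ (by positivity)]
    rw [div_le_iff₀ (by positivity)] at e1
    have hp3 : 1 ≤ 64 * π^2 := by nlinarith [Real.pi_gt_three]
    nlinarith
  · have := PP_gain (θ := θ) ht (fun j => Real.sin ((2*j+1)*θ/2)^2) J n hJn hJ1 (fun _ _ => by positivity)
      (fun _ _ => Real.sin_sq_le_one _)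
      (by
        intro j hj
        have hj1 : (2*(j:ℝ)+1) * t ≤ 1 := by
          refine le_trans ?_ hJ1
          have : (j:ℝ) + 1 ≤ J := by exact_mod_cast hj
          gcongr
          linarith
        have : ((2*(j:ℝ)+1) * t)^2 ≤ 1 := pow_le_one₀ (by positivity) hj1
        nlinarith [sq_nonneg (Real.sin ((2*j+1)*θ/2))])
    refine this.trans ?_
    gcongr
    refine le_trans ?_ (div_le_div_of_nonneg_right (le_max_right _ _) (by positivity))
    have hss := sin_sum_ge ht ht2 h hθ
    have e1 : Real.exp (-(∑ j ∈ Finset.range J, Real.sin ((2*j+1)*θ/2)^2)/4) ≤ Real.exp (-(1/128)/t) := by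
      apply Real.exp_le_exp.2
      have : (1/128)/t = 1/(4*t)/8/4 := by field_simp; norm_num
      rw [neg_div, neg_div, this]
      gcongr
      refine le_trans ?_ hss
      gcongr
    refine e1.trans ((exp_small _ (by norm_num) ht).trans ?_)
    rw [le_div_iff₀ (by positivity)]
    have h3 : t^4 * (1 + θ^2/t^3) ≤ 1 + π^2 := by
      have : t^4 * (1 + θ^2/t^3) = t^4 + t * θ^2 := by field_simp
      rw [this]
      have a1 : t^4 ≤ 1 := pow_le_one₀ ht.le (by linarith)
      have a2 : θ^2 ≤ π^2 := by rw [← sq_abs]; gcongr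
      nlinarith [sq_nonneg θ]
    calc 24 / (1/128)^4 * t^4 * (1 + θ^2/t^3) = 24 * 128^4 * (t^4 * (1 + θ^2/t^3)) := by norm_num; ring
      _ ≤ _ := by gcongr
end

open Complex Real Filter Topology
noncomputable section

/-! ### Part VI: domination and approximation of `VV 1` -/

lemma tele_bound (r : ℝ) (h0 : 0 < r) (h1 : r < 1) (N : ℕ) :
    ∑ n ∈ Finset.range N, r^n * PP (1:ℝ) r n ≤ PR r / (2*r) := by
  have key : 2 * r * ∑ n ∈ Finset.range N, r^n * PP (1:ℝ) r n ≤ PP (1:ℝ) r N := by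
    induction N with
    | zero => simpa using (PP_pos r h0 h1 0).le
    | succ N ih =>
      rw [Finset.sum_range_succ, mul_add]
      have := PP_step r h0 h1 N
      have e : 2 * r * (r^N * PP (1:ℝ) r N) = PP (1:ℝ) r N * (2 * r^(N+1)) := by ring
      rw [e]
      linarith
  rw [le_div_iff₀ (by positivity)]
  have := PP_le r h0 h1 N
  linarith

lemma VV_dom : ∃ C > 0, ∀ t θ : ℝ, 0 < t → t ≤ 1/8 → |θ| ≤ π →
    ‖VV 1 (cexp (-(t + I * θ)))‖ ≤ C / (1 + θ^2/t^3) * PR (Real.exp (-t)) := by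
  obtain ⟨C, hC, hCb⟩ := PP_late_one
  have hd := del1_pos
  have hpi := Real.pi_pos
  refine ⟨C + 48/del1^4*(1+π^2), by positivity, ?_⟩
  intro t θ ht ht2 hθ
  have hnorm : ‖cexp (-(t + I * θ))‖ = Real.exp (-t) := by
    rw [Complex.norm_exp]; simp
  have hb := hCb t θ ht ht2 hθ
  set q := cexp (-(t + I * θ))
  have h0 := Real.exp_pos (-t)
  have h1 := er_lt ht
  have hearly := PP_early ht (by linarith)
  have hes := exp_small del1 hd ht
  have hr1 : 1 - t ≤ Real.exp (-t) := by have := Real.add_one_le_exp (-t); linarith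
  have hr2 : Real.exp (-t) ≤ 1 - t/2 := by
    have h : 1 + t ≤ Real.exp t := by have := Real.add_one_le_exp t; linarith
    rw [Real.exp_neg, inv_le_comm₀ (Real.exp_pos _) (by linarith)]
    refine le_trans ?_ h
    rw [inv_le_iff_one_le_mul₀ (by linarith)]
    nlinarith
  set r := Real.exp (-t)
  set A := C / (1 + θ^2/t^3)
  have hA : 0 ≤ A := by positivity
  have hPR : 0 ≤ PR r := norm_nonneg _
  set B := Real.exp (-del1/t) * PR r
  have hB : 0 ≤ B := by positivity
  have hterm : ∀ n, ‖q^n * PP 1 q n‖ ≤ A * (r^n * PP (1:ℝ) r n) + B * r^n := by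
    intro n
    have hp := (PP_pos r h0 h1 n).le
    rw [norm_mul, norm_pow, hnorm]
    rcases le_total ⌊1/t⌋₊ n with h | h
    · have := hb n h
      calc r^n * ‖PP 1 q n‖ ≤ r^n * (A * PP (1:ℝ) r n) := by gcongr
        _ ≤ _ := by
          have : 0 ≤ B * r^n := by positivity
          linarith
    · have := hearly n h
      have h2 := PP_norm_le 1 q (by simp) (by rw [hnorm]; exact h0) (by rw [hnorm]; exact h1) n
      rw [hnorm] at h2
      calc r^n * ‖PP 1 q n‖ ≤ r^n * B := by gcongr; exact h2.trans this
        _ ≤ _ := by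
          have : 0 ≤ A * (r^n * PP (1:ℝ) r n) := by positivity
          linarith
  have hpn : ∀ n, 0 ≤ r^n * PP (1:ℝ) r n := fun n => by
    have := (PP_pos r h0 h1 n).le
    positivity
  have s1 : Summable (fun n => r^n * PP (1:ℝ) r n) :=
    summable_of_sum_range_le hpn (tele_bound r h0 h1)
  have s2 : Summable (fun n : ℕ => r^n) := summable_geometric_of_lt_one h0.le h1
  have hsum : Summable (fun n => A * (r^n * PP (1:ℝ) r n) + B * r^n) :=
    (s1.mul_left A).add (s2.mul_left B)
  have hVV : ‖VV 1 q‖ ≤ A * (PR r / (2*r)) + B * (1-r)⁻¹ := by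
    unfold VV
    refine (tsum_of_norm_bounded hsum.hasSum hterm).trans ?_
    rw [(s1.mul_left A).tsum_add (s2.mul_left B), tsum_mul_left, tsum_mul_left,
      tsum_geometric_of_lt_one h0.le h1]
    have := s1.tsum_le_of_sum_range_le (tele_bound r h0 h1)
    gcongr
  refine hVV.trans ?_
  have e1 : PR r / (2*r) ≤ PR r := by
    rw [div_le_iff₀ (by positivity)]
    nlinarith
  have e2 : (1-r)⁻¹ ≤ 2/t := by
    rw [inv_le_comm₀ (by linarith) (by positivity), inv_div]
    linarith
  have e3 : B * (1-r)⁻¹ ≤ (48/del1^4*(1+π^2)) / (1 + θ^2/t^3) * PR r := by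
    calc B * (1-r)⁻¹ ≤ (24/del1^4*t^4 * PR r) * (2/t) := by
          apply mul_le_mul _ e2 (inv_nonneg.2 (by linarith)) (by positivity)
          exact mul_le_mul_of_nonneg_right hes hPR
      _ = 48/del1^4 * t^3 * PR r := by field_simp; ring
      _ ≤ _ := by
          gcongr
          rw [le_div_iff₀ (by positivity), mul_assoc]
          gcongr
          have : t^3 * (1 + θ^2/t^3) = t^3 + θ^2 := by field_simp
          rw [this]
          have a1 : t^3 ≤ 1 := pow_le_one₀ ht.le (by linarith)
          have a2 : θ^2 ≤ π^2 := by rw [← sq_abs]; gcongr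
          linarith
  calc _ ≤ A * PR r + (48/del1^4*(1+π^2)) / (1 + θ^2/t^3) * PR r := by gcongr
    _ = _ := by simp only [A]; ring

/-- the error factor -/
def eN {K : Type*} [Field K] (q : K) (n : ℕ) : K :=
  (q^(2*n+2) + q^(2*n+3) + 2 * q^(3*n+4)) / (1 - q^(2*n+3))

lemma eN_real (r : ℝ) (h0 : 0 < r) (h1 : r < 1) (n : ℕ) :
    PP (1:ℝ) r n * eN r n ≤ 2 * (r^n * (PP (1:ℝ) r (n+2) - PP (1:ℝ) r (n+1))) := by
  have h := PP_succ r (by rwa [Real.norm_of_nonneg h0.le]) n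
  have hp := PP_pos r h0 h1 n
  have hp1 := PP_pos r h0 h1 (n+1)
  have h3 : 0 < 1 - r^(2*n+3) := by
    have := pow_lt_one₀ h0.le h1 (show 2*n+3 ≠ 0 by omega); linarith
  have hst := PP_step r h0 h1 (n+1)
  have h4 : PP (1:ℝ) r n ≤ PP (1:ℝ) r (n+1) * (1 - r^(2*n+3)) := by
    have e : PP (1:ℝ) r (n+1) * (1 - r^(2*n+3)) = PP (1:ℝ) r n * (1 + r^(n+1))^2 := by
      have : PP (1:ℝ) r (n+1) = PP (1:ℝ) r n + 2*r^(n+1)*PP 1 r n + PP 1 r n*((r^(2*n+2)+r^(2*n+3)+2*r^(3*n+4))/(1-r^(2*n+3))) := by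
        linarith
      rw [this]
      field_simp
      ring
    rw [e]
    have : 1 ≤ (1 + r^(n+1))^2 := one_le_pow₀ (by linarith [pow_pos h0 (n+1)])
    nlinarith
  have h5 : r^(2*n+2) + r^(2*n+3) + 2 * r^(3*n+4) ≤ 4 * r^(2*n+2) := by
    have a : r^(2*n+3) ≤ r^(2*n+2) := pow_le_pow_of_le_one h0.le h1.le (by omega)
    have b : r^(3*n+4) ≤ r^(2*n+2) := pow_le_pow_of_le_one h0.le h1.le (by omega)
    linarith
  calc PP (1:ℝ) r n * eN r n ≤ (PP (1:ℝ) r (n+1) * (1 - r^(2*n+3))) * (4 * r^(2*n+2) / (1 - r^(2*n+3))) := by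
        unfold eN
        gcongr
    _ = 2 * (r^n * (PP (1:ℝ) r (n+1) * (2 * r^(n+1+1)))) := by
        field_simp; ring
    _ ≤ _ := by
        gcongr
        linarith

lemma eN_norm (q : ℂ) (hq : ‖q‖ < 1) (n : ℕ) : ‖eN q n‖ ≤ eN ‖q‖ n := by
  unfold eN
  rw [norm_div]
  have h3 : 0 < 1 - ‖q‖^(2*n+3) := by
    have := pow_lt_one₀ (norm_nonneg q) hq (show 2*n+3 ≠ 0 by omega); linarith
  apply div_le_div₀ (by positivity) _ h3
  · have := norm_sub_norm_le (1:ℂ) (q^(2*n+3))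
    simpa using this
  · refine (norm_add₃_le).trans ?_
    simp

lemma err_sum (r : ℝ) (h0 : 0 < r) (h1 : r < 1) (M N : ℕ) :
    ∑ n ∈ Finset.range N, r^n * (PP (1:ℝ) r (n+2) - PP (1:ℝ) r (n+1)) ≤
      PP (1:ℝ) r (M+1) + r^M * PR r := by
  have key : ∑ n ∈ Finset.range N, r^n * (PP (1:ℝ) r (n+2) - PP (1:ℝ) r (n+1)) ≤
      PP (1:ℝ) r (min N M+1) + r^M * PP (1:ℝ) r (N+1) := by
    induction N with
    | zero => 
      have := PP_pos r h0 h1 1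
      simp; positivity
    | succ N ih =>
      rw [Finset.sum_range_succ]
      have hm : PP (1:ℝ) r (N+1) ≤ PP (1:ℝ) r (N+2) := PP_mono r h0 h1 (by omega)
      have hpw : 0 < r^M := by positivity
      rcases lt_or_ge N M with h | h
      · rw [min_eq_left h.le] at ih
        rw [min_eq_left (by omega)]
        have : r^N ≤ 1 := pow_le_one₀ h0.le h1.le
        show _ ≤ PP (1:ℝ) r (N+2) + r^M * PP (1:ℝ) r (N+2)
        nlinarith
      · rw [min_eq_right h] at ih
        rw [min_eq_right (by omega)]
        have : r^N ≤ r^M := pow_le_pow_of_le_one h0.le h1.le h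
        show _ ≤ _ + r^M * PP (1:ℝ) r (N+2)
        nlinarith
  refine key.trans ?_
  have a : PP (1:ℝ) r (min N M+1) ≤ PP (1:ℝ) r (M+1) := PP_mono r h0 h1 (by omega)
  have b := PP_le r h0 h1 (N+1)
  gcongr

lemma VV_approx_aux (q : ℂ) (h0 : 0 < ‖q‖) (hq : ‖q‖ < 1) (M : ℕ) :
    ‖2 * q * VV 1 q - Pinf q‖ ≤ 3 * PP (1:ℝ) ‖q‖ (M+1) + 2 * (‖q‖^M * PR ‖q‖) := by
  have hsum : Summable (fun n => q^n * PP 1 q n) := by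
    refine Summable.of_norm_bounded (g := fun n => ‖q‖^n * PP (1:ℝ) ‖q‖ n) ?_ ?_
    · refine summable_of_sum_range_le (fun n => ?_) (tele_bound _ h0 hq)
      have := (PP_pos _ h0 hq n).le
      positivity
    · intro n
      rw [norm_mul, norm_pow]
      gcongr
      exact PP_norm_le 1 q (by simp) h0 hq n
  have hlim : Tendsto (fun N => 2 * q * ∑ n ∈ Finset.range N, q^n * PP 1 q n - PP 1 q N) atTop
      (𝓝 (2 * q * VV 1 q - Pinf q)) :=
    (hsum.hasSum.tendsto_sum_nat.const_mul (2*q)).sub (PP_tendsto q hq)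
  refine le_of_tendsto hlim.norm (Eventually.of_forall fun N => ?_)
  have e : 2 * q * ∑ n ∈ Finset.range N, q^n * PP 1 q n - PP 1 q N =
      - PP 1 q 0 - ∑ n ∈ Finset.range N, PP 1 q n * eN q n := by
    induction N with
    | zero => simp
    | succ N ih =>
      rw [Finset.sum_range_succ, Finset.sum_range_succ]
      have := PP_succ q hq N
      unfold eN at ih ⊢
      linear_combination ih - this
  rw [e]
  have hP0 : ‖PP 1 q 0‖ ≤ PP (1:ℝ) ‖q‖ (M+1) :=
    (PP_norm_le 1 q (by simp) h0 hq 0).trans (PP_mono _ h0 hq (by omega))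
  have hs : ‖∑ n ∈ Finset.range N, PP 1 q n * eN q n‖ ≤ 2 * (PP (1:ℝ) ‖q‖ (M+1) + ‖q‖^M * PR ‖q‖) := by
    calc _ ≤ ∑ n ∈ Finset.range N, 2 * (‖q‖^n * (PP (1:ℝ) ‖q‖ (n+2) - PP (1:ℝ) ‖q‖ (n+1))) := by
          refine norm_sum_le_of_le _ fun n _ => ?_
          refine le_trans ?_ (eN_real _ h0 hq n)
          rw [norm_mul]
          exact mul_le_mul (PP_norm_le 1 q (by simp) h0 hq n) (eN_norm q hq n) (norm_nonneg _)
            (PP_pos _ h0 hq n).le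
      _ ≤ _ := by
          rw [← Finset.mul_sum]
          gcongr
          exact err_sum _ h0 hq M N
  calc _ ≤ ‖PP 1 q 0‖ + ‖∑ n ∈ Finset.range N, PP 1 q n * eN q n‖ := by
        refine (norm_sub_le _ _).trans ?_
        rw [norm_neg]
    _ ≤ _ := by linarith

lemma VV_approx (ε : ℝ) (hε : 0 < ε) : ∀ᶠ t in 𝓝[>] (0:ℝ), ∀ q : ℂ, ‖q‖ = Real.exp (-t) →
    ‖2 * q * VV 1 q - Pinf q‖ ≤ ε * PR (Real.exp (-t)) := by
  obtain ⟨K, hK1, hK2⟩ : ∃ K : ℝ, 1 ≤ K ∧ 2 * Real.exp (-(K-1)) ≤ ε/2 := by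
    have h : Tendsto (fun K : ℝ => 2 * Real.exp (-(K-1))) atTop (𝓝 (2*0)) := by
      apply Tendsto.const_mul
      apply Real.tendsto_exp_neg_atTop_nhds_zero.comp
      exact tendsto_atTop_add_const_right _ _ tendsto_id
    rw [mul_zero] at h
    have := (eventually_ge_atTop (1:ℝ)).and (h.eventually (eventually_le_nhds (by positivity : 0 < ε/2)))
    exact this.exists
  have hev : ∀ᶠ t in 𝓝[>] (0:ℝ), 6/ε ≤ 1 + 2 * (K/t - 1) * Real.exp (-(2*K+1)) := by
    have h : Tendsto (fun t : ℝ => 1 + (K * t⁻¹ - 1) * (2 * Real.exp (-(2*K+1)))) (𝓝[>] 0) atTop := by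
      apply tendsto_atTop_add_const_left
      apply Tendsto.atTop_mul_const (by positivity)
      apply tendsto_atTop_add_const_right
      exact tendsto_inv_nhdsGT_zero.const_mul_atTop (by linarith)
    filter_upwards [h.eventually_ge_atTop (6/ε)] with t ht
    rw [div_eq_mul_inv K t]
    linarith
  have h1 : ∀ᶠ t in 𝓝[>] (0:ℝ), t ≤ 1 := 
    eventually_nhdsWithin_of_eventually_nhds (eventually_le_nhds (by norm_num))
  filter_upwards [hev, h1, self_mem_nhdsWithin] with t h2 h3 h4 q hq
  have ht : 0 < t := h4
  have hr0 := Real.exp_pos (-t)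
  have hr1 := er_lt ht
  have h := VV_approx_aux q (by rw [hq]; exact hr0) (by rw [hq]; exact hr1) ⌊K/t⌋₊
  rw [hq] at h
  have f1 := Nat.floor_le (show 0 ≤ K/t by positivity)
  have f2 := Nat.lt_floor_add_one (K/t)
  set M := ⌊K/t⌋₊
  have hg := PP_growth _ hr0 hr1 (M+1) M
  have hp := PP_pos _ hr0 hr1 (M+1)
  have hPR : 0 ≤ PR (Real.exp (-t)) := norm_nonneg _
  have f1' : M * t ≤ K := by rwa [le_div_iff₀ ht] at f1
  have f2' : K - 1 ≤ M * t := by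
    rw [div_lt_iff₀ ht] at f2; linarith
  have g1 : Real.exp (-t)^M ≤ Real.exp (-(K-1)) := by
    rw [← Real.exp_nat_mul]
    apply Real.exp_le_exp.2; linarith
  have g2 : Real.exp (-(2*K+1)) ≤ Real.exp (-t)^(M+1+M) := exp_pow_ge ht (by push_cast; linarith)
  have g3 : 6/ε ≤ (1 + 2 * Real.exp (-t)^(M+1+M))^M := by
    calc 6/ε ≤ 1 + 2 * (K/t - 1) * Real.exp (-(2*K+1)) := h2
      _ ≤ 1 + (M:ℝ) * (2 * Real.exp (-(2*K+1))) := by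
          have : K/t - 1 ≤ M := by linarith
          have := mul_le_mul_of_nonneg_right this (Real.exp_pos (-(2*K+1))).le
          linarith
      _ ≤ 1 + (M:ℝ) * (2 * Real.exp (-t)^(M+1+M)) := by gcongr
      _ ≤ _ := one_add_mul_le_pow (by have := pow_pos hr0 (M+1+M); linarith) M
  have g4 : PP (1:ℝ) (Real.exp (-t)) (M+1) * (6/ε) ≤ PR (Real.exp (-t)) := by
    refine le_trans ?_ hg
    gcongr
  have g5 : 3 * PP (1:ℝ) (Real.exp (-t)) (M+1) ≤ ε/2 * PR (Real.exp (-t)) := by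
    rw [mul_div_assoc', div_le_iff₀ hε] at g4
    linarith
  have g6 : 2 * (Real.exp (-t)^M * PR (Real.exp (-t))) ≤ ε/2 * PR (Real.exp (-t)) := by
    have := mul_le_mul_of_nonneg_right (g1) hPR
    nlinarith
  linarith
end

open Complex Real Filter Topology
noncomputable section

/-! ### Part VII: the eta asymptotics -/

lemma eta_eq (τ : ℂ) : ModularForm.eta τ = cexp (2*π*I*τ/24) * EE (cexp (2*π*I*τ)) := by
  unfold ModularForm.eta EE
  simp only [ModularForm.eta_q_eq_pow]
  congr 1
  

lemma csqrt_two_mul (τ : ℂ) (h : τ ≠ 0) : Complex.sqrt (2*τ) = (√2 : ℝ) * Complex.sqrt τ := by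
  unfold Complex.sqrt
  rw [Complex.cpow_def_of_ne_zero (by simpa using h), Complex.cpow_def_of_ne_zero h]
  have : Complex.log (2*τ) = Real.log 2 + Complex.log τ := by
    have := Complex.log_ofReal_mul (r := 2) (by norm_num) h
    simpa using this
  rw [this, add_mul, Complex.exp_add]
  congr 1
  rw [← Real.exp_log (show 0 < √2 by positivity), Real.log_sqrt (by norm_num)]
  push_cast
  congr 1

/-- the ratio which tends to one -/
def GG (z : ℂ) : ℂ := EE (cexp (-(2*π^2/z))) / EE (cexp (-(4*π^2/z)))

lemma EE_ratio (z : ℂ) (hz : 0 < z.re) :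
    EE (cexp (-z)^2) / EE (cexp (-z)) = (√2 : ℝ)⁻¹ * cexp (z/24 + π^2/(12*z)) * GG z := by
  have hz0 : z ≠ 0 := by rintro rfl; simp at hz
  have hpi : (π:ℂ) ≠ 0 := by exact_mod_cast Real.pi_ne_zero
  set τ := I*z/(2*π) with hτ
  have hτ0 : τ ≠ 0 := by
    rw [hτ]; exact div_ne_zero (mul_ne_zero I_ne_zero hz0) (by simp)
  have him : τ ∈ UpperHalfPlane.upperHalfPlaneSet := by
    show 0 < τ.im
    have : τ = ((2*π)⁻¹ : ℝ) * (I * z) := by rw [hτ]; push_cast; field_simp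
    rw [this, Complex.im_ofReal_mul, Complex.I_mul_im]
    have := Real.pi_pos
    positivity
  have him2 : 2*τ ∈ UpperHalfPlane.upperHalfPlaneSet := by
    show 0 < (2*τ).im
    have : (2*τ).im = 2 * τ.im := by simp
    rw [this]
    have : 0 < τ.im := him
    positivity
  have hs : Complex.sqrt I ≠ 0 := by simp [Complex.sqrt]
  have hσ : Complex.sqrt τ ≠ 0 := by simp [Complex.sqrt, hτ0]
  have h1 : ModularForm.eta (-1/τ) = (Complex.sqrt I)⁻¹ * (Complex.sqrt τ * ModularForm.eta τ) :=
    ModularForm.eta_comp_eq_csqrt_I_inv him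
  have h2 : ModularForm.eta (-1/(2*τ)) =
      (Complex.sqrt I)⁻¹ * (Complex.sqrt (2*τ) * ModularForm.eta (2*τ)) :=
    ModularForm.eta_comp_eq_csqrt_I_inv him2
  rw [csqrt_two_mul τ hτ0] at h2
  simp only [eta_eq] at h1 h2
  have hII : I * I = -1 := I_mul_I
  have c1 : 2*π*I*τ = -z := by
    rw [hτ]; field_simp; simp
  have c2 : 2*π*I*(2*τ) = -z + -z := by linear_combination 2 * c1
  have c3 : 2*π*I*(-1/τ) = -(4*π^2/z) := by
    rw [hτ]; field_simp; norm_num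
  have c4 : 2*π*I*(-1/(2*τ)) = -(2*π^2/z) := by
    rw [hτ]; field_simp
  have hq2 : cexp (-z)^2 = cexp (-z + -z) := by rw [Complex.exp_add, sq]
  rw [c1, c3] at h1
  rw [c2, c4, ← hq2] at h2
  have d1 : cexp (-z/24) = (cexp (z/24))⁻¹ := by rw [← Complex.exp_neg]; ring_nf
  have d2 : cexp ((-z + -z)/24) = (cexp (z/24))⁻¹^2 := by
    rw [← Complex.exp_neg, ← Complex.exp_nat_mul]; congr 1; push_cast; ring
  have d3 : cexp (-(4*π^2/z)/24) = (cexp (π^2/(12*z)))⁻¹^2 := by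
    rw [← Complex.exp_neg, ← Complex.exp_nat_mul]; congr 1; push_cast; field_simp; norm_num
  have d4 : cexp (-(2*π^2/z)/24) = (cexp (π^2/(12*z)))⁻¹ := by
    rw [← Complex.exp_neg]; congr 1; field_simp; norm_num
  rw [d1, d3] at h1
  rw [d2, d4] at h2
  rw [Complex.exp_add, GG]
  have hA := Complex.exp_ne_zero (z/24)
  have hB := Complex.exp_ne_zero (π^2/(12*z))
  have hE1 : EE (cexp (-z)) ≠ 0 := EE_ne _ (by rw [Complex.norm_exp]; simpa using hz)
  have hre : 0 < (4*π^2/z).re := by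
    have : (4*(π:ℂ)^2/z) = ((4*π^2 : ℝ):ℂ) * z⁻¹ := by push_cast; ring
    rw [this, Complex.re_ofReal_mul, Complex.inv_re]
    have := Complex.normSq_pos.2 hz0
    have := Real.pi_pos
    positivity
  have hE4 : EE (cexp (-(4*π^2/z))) ≠ 0 := EE_ne _ (by rw [Complex.norm_exp]; simpa using hre)
  have h2r : ((√2:ℝ):ℂ) ≠ 0 := by simp
  push_cast
  generalize cexp (z/24) = A at *
  generalize cexp (π^2/(12*z)) = B at *
  generalize EE (cexp (-z)^2) = X at *
  generalize EE (cexp (-z)) = Y at *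
  generalize EE (cexp (-(4*π^2/z))) = Z at *
  generalize EE (cexp (-(2*π^2/z))) = W at *
  generalize Complex.sqrt I = s at *
  generalize Complex.sqrt τ = σ at *
  generalize ((√2:ℝ):ℂ) = v at *
  field_simp at h1 h2 ⊢
  have hne : s * A ≠ 0 := mul_ne_zero hs hA
  have hp : B * σ ≠ 0 := mul_ne_zero hB hσ
  apply mul_left_cancel₀ (mul_ne_zero hne hp)
  linear_combination (B*σ*v*X) * h1 - (B^2*σ*Y) * h2

lemma EE_zero : Tendsto EE (𝓝 0) (𝓝 1) := by
  unfold EE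
  have := tendsto_tprod_one_add_of_dominated_convergence (𝓕 := 𝓝 0) (g := 0)
    (f := fun (q : ℂ) (n : ℕ) ↦ -q ^ (n + 1)) (bound := fun n ↦ (1 / 2 : ℝ) ^ (n + 1))
  simp only [Pi.zero_apply, norm_neg, norm_pow, add_zero, tprod_one] at this
  simp_rw [sub_eq_add_neg]
  refine this
    (by simpa only [pow_succ'] using (summable_geometric_of_abs_lt_one (by norm_num)).mul_left _)
    (fun k ↦ by simpa using ((continuous_pow (M := ℂ) (k + 1)).tendsto 0).neg) ?_
  filter_upwards [Metric.ball_mem_nhds (0 : ℂ) (by norm_num : (0 : ℝ) < 1 / 2)] with q hq k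
  exact pow_le_pow_left₀ (norm_nonneg _) (mem_ball_zero_iff.mp hq).le _

lemma Pinf_eq (z : ℂ) (hz : 0 < z.re) :
    Pinf (cexp (-z)) = ((√2 : ℝ)⁻¹)^3 * cexp (z/8 + π^2/(4*z)) * GG z ^ 3 := by
  rw [Pinf, EE_ratio z hz, mul_pow, mul_pow, ← Complex.exp_nat_mul]
  congr 3
  have hz0 : z ≠ 0 := by rintro rfl; simp at hz
  push_cast; field_simp; ring

/-- the path -/
def zz (x u : ℝ) : ℂ := ((u^2 : ℝ) : ℂ) + I * ((x*u^3 : ℝ) : ℂ)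

lemma zz_re (x u : ℝ) : (zz x u).re = u^2 := by simp [zz, ← Complex.ofReal_pow]

lemma zz_tendsto (x : ℝ) : Tendsto (zz x) (𝓝[>] 0) (𝓝 0) := by
  have : Continuous (zz x) := by unfold zz; fun_prop
  have h := this.tendsto 0
  have h0 : zz x 0 = 0 := by simp [zz, ← Complex.ofReal_pow]
  rw [h0] at h
  exact h.mono_left nhdsWithin_le_nhds

lemma zz_factor (x u : ℝ) : zz x u = (u:ℂ)^2 * (1 + I * x * u) := by
  simp [zz]; ring

lemma inv_zz_re (x : ℝ) : Tendsto (fun u => ((zz x u)⁻¹).re) (𝓝[>] 0) atTop := by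
  have e : ∀ u : ℝ, 0 < u → ((zz x u)⁻¹).re = (u^2*(1+x^2*u^2))⁻¹ := by
    intro u hu
    rw [Complex.inv_re, zz_re, Complex.normSq_apply, zz_re]
    have : (zz x u).im = x*u^3 := by simp [zz, ← Complex.ofReal_pow]
    rw [this]
    field_simp
  have h : Tendsto (fun u : ℝ => u^2*(1+x^2*u^2)) (𝓝[>] 0) (𝓝[>] 0) := by
    apply tendsto_nhdsWithin_of_tendsto_nhds_of_eventually_within
    · have : Continuous (fun u : ℝ => u^2*(1+x^2*u^2)) := by fun_prop
      have h := this.tendsto 0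
      simp only [ne_eq, OfNat.ofNat_ne_zero, not_false_eq_true, zero_pow, zero_mul] at h
      exact h.mono_left nhdsWithin_le_nhds
    · filter_upwards [self_mem_nhdsWithin] with u hu
      have : 0 < u := hu
      simp only [Set.mem_Ioi]
      positivity
  refine (tendsto_inv_nhdsGT_zero.comp h).congr' ?_
  filter_upwards [self_mem_nhdsWithin] with u hu
  rw [e u hu]; rfl

lemma exp_zz (x a : ℝ) (ha : 0 < a) : Tendsto (fun u => cexp (-(a/zz x u))) (𝓝[>] 0) (𝓝 0) := by
  rw [tendsto_zero_iff_norm_tendsto_zero]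
  have : ∀ u, ‖cexp (-(a/zz x u))‖ = Real.exp (-(a * ((zz x u)⁻¹).re)) := by
    intro u
    rw [Complex.norm_exp, Complex.neg_re, div_eq_mul_inv, Complex.re_ofReal_mul]
  simp_rw [this]
  exact Real.tendsto_exp_neg_atTop_nhds_zero.comp ((inv_zz_re x).const_mul_atTop ha)

lemma GG_tendsto (x : ℝ) : Tendsto (fun u => GG (zz x u)) (𝓝[>] 0) (𝓝 1) := by
  have hpi := Real.pi_pos
  have h1 := EE_zero.comp (exp_zz x (2*π^2) (by positivity))
  have h2 := EE_zero.comp (exp_zz x (4*π^2) (by positivity))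
  have := h1.div h2 one_ne_zero
  rw [div_one] at this
  refine this.congr fun u => ?_
  simp [GG]

lemma PR_eq (t : ℝ) (ht : 0 < t) :
    PR (Real.exp (-t)) = ((√2)⁻¹)^3 * Real.exp (t/8 + π^2/(4*t)) * ‖GG t‖^3 := by
  rw [PR]
  have : ((Real.exp (-t) : ℝ) : ℂ) = cexp (-(t:ℂ)) := by push_cast; rfl
  rw [this, Pinf_eq t (by simpa using ht), norm_mul, norm_mul, norm_pow, norm_pow, Complex.norm_exp]
  congr 2
  · simp [abs_of_pos]
  · congr 1
    have : (t:ℂ)/8 + π^2/(4*t) = ((t/8+π^2/(4*t) : ℝ) : ℂ) := by push_cast; ring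
    rw [this, Complex.ofReal_re]

lemma Pinf_path (x : ℝ) : Tendsto (fun u : ℝ => Pinf (cexp (-zz x u)) *
    cexp (π^2/(4*u^4) * (I * (x*u^3 : ℝ))) / (PR (Real.exp (-u^2)) : ℝ)) (𝓝[>] 0)
    (𝓝 (cexp (-(π^2/4*x^2)))) := by
  have hg := GG_tendsto x
  have hg0 : Tendsto (fun u : ℝ => ((‖GG (zz 0 u)‖ : ℝ) : ℂ)) (𝓝[>] 0) (𝓝 1) := by
    have := (Complex.continuous_ofReal.tendsto _).comp (GG_tendsto 0).norm
    simpa [Function.comp_def] using this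
  have hexp : Tendsto (fun u : ℝ => cexp (I * ((x*u^3:ℝ):ℂ)/8 - π^2/4*(x^2/(1 + I * x * u)))) (𝓝[>] 0)
      (𝓝 (cexp (-(π^2/4*x^2)))) := by
    have hc : ContinuousAt (fun u : ℝ => cexp (I * ((x*u^3:ℝ):ℂ)/8 - π^2/4*(x^2/(1 + I * x * u)))) 0 := by
      have : (1 + I * x * ((0:ℝ):ℂ)) ≠ 0 := by simp
      fun_prop (disch := assumption)
    have := hc.tendsto.mono_left (nhdsWithin_le_nhds (s := Set.Ioi 0))
    simpa using this
  have := (hexp.mul (hg.pow 3)).div (hg0.pow 3) (by simp)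
  simp only [one_pow, mul_one, div_one] at this
  refine this.congr' ?_
  have hg0' := hg0.eventually_ne one_ne_zero
  filter_upwards [self_mem_nhdsWithin, hg0'] with u hu hne
  have hu : 0 < u := hu
  have hu' : (u:ℂ) ≠ 0 := by exact_mod_cast hu.ne'
  have hz : 0 < (zz x u).re := by rw [zz_re]; positivity
  have hz0 : zz x u ≠ 0 := fun h => by rw [h] at hz; simp at hz
  have hf : (1 + I * x * (u:ℂ)) ≠ 0 := by
    rw [zz_factor] at hz0
    exact right_ne_zero_of_mul hz0
  have e0 : zz 0 u = ((u^2:ℝ):ℂ) := by simp [zz, ← Complex.ofReal_pow]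
  rw [Pinf_eq _ hz, PR_eq _ (by positivity : 0 < u^2)]
  simp only [Pi.div_apply]
  rw [e0] at hne ⊢
  have h2r : ((√2:ℝ):ℂ) ≠ 0 := by simp
  simp only [Complex.ofReal_mul, Complex.ofReal_pow, Complex.ofReal_exp, Complex.ofReal_inv] at *
  have key : cexp (I * (x*u^3)/8 - π^2/4*(x^2/(1 + I * x * u))) * cexp (((u^2/8 + π^2/(4*u^2) : ℝ)):ℂ) =
      cexp (zz x u/8 + π^2/(4*zz x u)) * cexp (π^2/(4*u^4) * (I * (x*u^3))) := by
    rw [← Complex.exp_add, ← Complex.exp_add]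
    congr 1
    have hI : Complex.I^2 = -1 := Complex.I_sq
    rw [zz_factor]
    push_cast
    field_simp
    linear_combination -(8*(π:ℂ)^2*x^2*u^2) * hI
  have hex := Complex.exp_ne_zero (((u^2/8 + π^2/(4*u^2) : ℝ)):ℂ)
  generalize cexp (((u^2/8 + π^2/(4*u^2) : ℝ)):ℂ) = e at *
  generalize cexp (I * (x*u^3)/8 - π^2/4*(x^2/(1 + I * x * u))) = a at *
  generalize cexp (zz x u/8 + π^2/(4*zz x u)) = b at *
  generalize cexp (π^2/(4*u^4) * (I * (x*u^3))) = d at *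
  field_simp
  linear_combination GG (zz x u)^3 * key
end

open Complex Real Filter Topology
noncomputable section

/-! ### Part VIII: assembling -/

lemma VV_cont (t : ℝ) (ht : 0 < t) : Continuous (fun θ : ℝ => VV 1 (cexp (-(t + I * θ)))) := by
  have hnorm : ∀ θ : ℝ, ‖cexp (-(t + I * θ))‖ = Real.exp (-t) := by
    intro θ; rw [Complex.norm_exp]; simp
  have hlt := er_lt ht
  have hsum : Summable (fun m => ‖coefOB 1 m * ((Real.exp (-t) : ℝ) : ℂ)^m‖) := by
    refine (coef_hasSum 1 _ (by simp) ?_ ?_).summable.norm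
    · rw [Complex.norm_real, Real.norm_of_nonneg (Real.exp_pos _).le]; exact Real.exp_pos _
    · rw [Complex.norm_real, Real.norm_of_nonneg (Real.exp_pos _).le]; exact hlt
  have e : (fun θ : ℝ => VV 1 (cexp (-(t + I * θ)))) =
      fun θ : ℝ => ∑' m, coefOB 1 m * cexp (-(t + I * θ))^m := by
    ext θ
    exact (coef_hasSum 1 _ (by simp) (by rw [hnorm]; exact Real.exp_pos _)
      (by rw [hnorm]; exact hlt)).tsum_eq.symm
  rw [e]
  refine continuous_tsum (fun m => by fun_prop) hsum fun m θ => ?_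
  rw [norm_mul, norm_mul, norm_pow, norm_pow, hnorm, Complex.norm_real,
    Real.norm_of_nonneg (Real.exp_pos _).le]

lemma PR_pos (t : ℝ) (ht : 0 < t) : 0 < PR (Real.exp (-t)) :=
  lt_of_lt_of_le (PP_pos _ (Real.exp_pos _) (er_lt ht) 0) (PP_le _ (Real.exp_pos _) (er_lt ht) 0)

/-- the phase -/
def ph (x u : ℝ) : ℂ := cexp (π^2/(4*u^4) * (I * (x*u^3 : ℝ)))

lemma ph_norm (x u : ℝ) : ‖ph x u‖ = 1 := by
  have : (π:ℂ)^2/(4*u^4) * (I * (x*u^3 : ℝ)) = ((π^2/(4*u^4) * (x*u^3) : ℝ) : ℂ) * I := by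
    push_cast; ring
  rw [ph, this, Complex.norm_exp_ofReal_mul_I]

/-- normalised integrand -/
def FF (u x : ℝ) : ℂ := VV 1 (cexp (-zz x u)) * ph x u / (PR (Real.exp (-u^2)) : ℝ)

lemma sq_tend : Tendsto (fun u : ℝ => u^2) (𝓝[>] 0) (𝓝[>] 0) := by
  apply tendsto_nhdsWithin_of_tendsto_nhds_of_eventually_within
  · have h := (continuous_pow (M := ℝ) 2).tendsto 0
    simp only [ne_eq, OfNat.ofNat_ne_zero, not_false_eq_true, zero_pow] at h
    exact h.mono_left nhdsWithin_le_nhds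
  · filter_upwards [self_mem_nhdsWithin] with u hu
    have : 0 < u := hu
    simp only [Set.mem_Ioi]
    positivity

lemma zz_norm (x u : ℝ) : ‖cexp (-zz x u)‖ = Real.exp (-u^2) := by
  rw [Complex.norm_exp, Complex.neg_re, zz_re]

lemma FF_tendsto (x : ℝ) : Tendsto (fun u => FF u x) (𝓝[>] 0) (𝓝 (cexp (-(π^2/4*x^2))/2)) := by
  have h1 := Pinf_path x
  have h2 : Tendsto (fun u => (2 * cexp (-zz x u) * VV 1 (cexp (-zz x u)) - Pinf (cexp (-zz x u))) *
      ph x u / (PR (Real.exp (-u^2)) : ℝ)) (𝓝[>] 0) (𝓝 0) := by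
    rw [Metric.tendsto_nhds]
    intro ε hε
    filter_upwards [sq_tend.eventually (VV_approx (ε/2) (by positivity)), self_mem_nhdsWithin] with u h hu
    have hu : 0 < u := hu
    have hP := PR_pos (u^2) (by positivity)
    rw [dist_zero_right, norm_div, norm_mul, ph_norm, mul_one, Complex.norm_real,
      Real.norm_of_nonneg hP.le, div_lt_iff₀ hP]
    refine (h _ (zz_norm x u)).trans_lt ?_
    gcongr
    linarith
  have h3 := h2.add h1
  rw [zero_add] at h3
  have hq : Tendsto (fun u => 2 * cexp (-zz x u)) (𝓝[>] 0) (𝓝 2) := by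
    have := ((Complex.continuous_exp.tendsto _).comp (zz_tendsto x).neg).const_mul 2
    simpa [Function.comp_def] using this
  have h4 := h3.div hq two_ne_zero
  refine h4.congr fun u => ?_
  have := Complex.exp_ne_zero (-zz x u)
  simp only [Pi.div_apply, FF]
  rw [← ph]
  field_simp
  ring

lemma FF_bound : ∃ C > 0, ∀ u x : ℝ, 0 < u → u ≤ 1/3 → |x * u^3| ≤ π → ‖FF u x‖ ≤ C * (1+x^2)⁻¹ := by
  obtain ⟨C, hC, h⟩ := VV_dom
  refine ⟨C, hC, fun u x hu hu2 hx => ?_⟩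
  have hP := PR_pos (u^2) (by positivity)
  have := h (u^2) (x*u^3) (by positivity) (by nlinarith) hx
  rw [FF, norm_div, norm_mul, ph_norm, mul_one, Complex.norm_real, Real.norm_of_nonneg hP.le,
    div_le_iff₀ hP]
  refine this.trans (le_of_eq ?_)
  have : (x*u^3)^2/(u^2)^3 = x^2 := by field_simp
  rw [this]; rfl

lemma FF_cont (u : ℝ) (hu : 0 < u) : Continuous (FF u) := by
  have h := (VV_cont (u^2) (by positivity)).comp (by fun_prop : Continuous fun x : ℝ => x*u^3)
  unfold FF
  apply Continuous.div_const
  apply Continuous.mul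
  · exact h
  · unfold ph; fun_prop

lemma int_tendsto : Tendsto (fun u : ℝ => ∫ x in (-(π/u^3))..(π/u^3), FF u x) (𝓝[>] 0)
    (𝓝 ((√π)⁻¹ : ℝ)) := by
  have hpi := Real.pi_pos
  obtain ⟨C, hC, hb⟩ := FF_bound
  have key : Tendsto (fun u : ℝ => ∫ x, (Set.Ioc (-(π/u^3)) (π/u^3)).indicator (FF u) x) (𝓝[>] 0)
      (𝓝 (∫ x : ℝ, cexp (-(π^2/4*x^2))/2)) := by
    refine MeasureTheory.tendsto_integral_filter_of_dominated_convergence (fun x => C * (1+x^2)⁻¹) ?_ ?_ ?_ ?_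
    · filter_upwards [self_mem_nhdsWithin] with u hu
      exact ((FF_cont u hu).aestronglyMeasurable).indicator measurableSet_Ioc
    · have h1 : ∀ᶠ u in 𝓝[>] (0:ℝ), u ≤ 1/3 :=
        eventually_nhdsWithin_of_eventually_nhds (eventually_le_nhds (by norm_num))
      filter_upwards [self_mem_nhdsWithin, h1] with u hu hu1
      have hu : 0 < u := hu
      refine .of_forall fun x => ?_
      by_cases hx : x ∈ Set.Ioc (-(π/u^3)) (π/u^3)
      · rw [Set.indicator_of_mem hx]
        apply hb u x hu hu1
        rw [abs_mul, abs_of_pos (by positivity : 0 < u^3), ← le_div_iff₀ (by positivity), abs_le]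
        exact ⟨hx.1.le, hx.2⟩
      · rw [Set.indicator_of_notMem hx, norm_zero]; positivity
    · exact integrable_inv_one_add_sq.const_mul C
    · refine .of_forall fun x => ?_
      refine (FF_tendsto x).congr' ?_
      have h1 : Tendsto (fun u : ℝ => |x| * u^3) (𝓝[>] 0) (𝓝 0) := by
        have : Continuous (fun u : ℝ => |x| * u^3) := by fun_prop
        have h := this.tendsto 0
        simp only [ne_eq, OfNat.ofNat_ne_zero, not_false_eq_true, zero_pow, mul_zero] at h
        exact h.mono_left nhdsWithin_le_nhds
      filter_upwards [self_mem_nhdsWithin, h1.eventually (eventually_lt_nhds hpi)] with u hu hlt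
      have hu : 0 < u := hu
      rw [Set.indicator_of_mem]
      rw [← lt_div_iff₀ (by positivity), abs_lt] at hlt
      exact ⟨hlt.1, hlt.2.le⟩
  have hval : ∫ x : ℝ, cexp (-(π^2/4*x^2))/2 = (((√π)⁻¹ : ℝ) : ℂ) := by
    have e : ∀ x : ℝ, cexp (-(π^2/4*x^2))/2 = ((Real.exp (-(π^2/4)*x^2)/2 : ℝ) : ℂ) := by
      intro x; push_cast; congr 2; ring
    simp_rw [e]
    rw [integral_complex_ofReal, MeasureTheory.integral_div, integral_gaussian]
    congr 1
    have : π/(π^2/4) = 2^2/π := by field_simp; norm_num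
    rw [this, Real.sqrt_div (by positivity), Real.sqrt_sq (by norm_num)]
    field_simp
  rw [hval] at key
  refine key.congr' ?_
  filter_upwards [self_mem_nhdsWithin] with u hu
  have hu : 0 < u := hu
  rw [intervalIntegral.integral_of_le, MeasureTheory.integral_indicator measurableSet_Ioc]
  have : 0 < π/u^3 := by positivity
  linarith

/-- the saddle point parameter -/
def uu (n : ℕ) : ℝ := √(π/2) / √(√n)

lemma uu_pos (n : ℕ) (hn : 0 < n) : 0 < uu n := by
  have := Real.pi_pos
  unfold uu; positivity

lemma uu_tendsto : Tendsto uu atTop (𝓝[>] 0) := by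
  apply tendsto_nhdsWithin_of_tendsto_nhds_of_eventually_within
  · unfold uu
    apply Tendsto.div_atTop tendsto_const_nhds
    exact Real.tendsto_sqrt_atTop.comp (Real.tendsto_sqrt_atTop.comp tendsto_natCast_atTop_atTop)
  · filter_upwards [eventually_gt_atTop 0] with n hn
    exact uu_pos n hn

lemma uu_sq (n : ℕ) : uu n ^ 2 = π/2/√n := by
  have := Real.pi_pos
  rw [uu, div_pow, Real.sq_sqrt (by positivity), Real.sq_sqrt (by positivity)]

lemma n_eq (n : ℕ) (hn : 0 < n) : (n:ℝ) = π^2/(4*uu n^4) := by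
  have hpi := Real.pi_pos
  have h : uu n^4 = (π/2)^2/n := by
    rw [show uu n^4 = (uu n^2)^2 by ring, uu_sq, div_pow, Real.sq_sqrt (by positivity)]
  rw [h]
  field_simp
  norm_num

lemma coef_int (n : ℕ) (hn : 0 < n) : coefOB 1 n = ((uu n^3 * Real.exp (n * uu n^2) * PR (Real.exp (-uu n^2)) : ℝ) : ℂ) *
    ((1/(2*π)) * ∫ x in (-(π/uu n^3))..(π/uu n^3), FF (uu n) x) := by
  have hu := uu_pos n hn
  have hne := n_eq n hn
  have hP := PR_pos (uu n^2) (by positivity)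
  rw [cauchy_coef 1 (by simp) (uu n^2) (by positivity) n]
  set u := uu n
  have hcv := intervalIntegral.integral_comp_mul_right (a := -(π/u^3)) (b := π/u^3)
    (fun θ : ℝ => VV 1 (cexp (-((u^2:ℝ) + I * θ))) * cexp (n * ((u^2:ℝ) + I * θ))) (c := u^3) (by positivity)
  have hb : π/u^3*u^3 = π := by field_simp
  rw [neg_mul, hb] at hcv
  have hfun : ∀ x : ℝ, VV 1 (cexp (-((u^2:ℝ) + I * (x*u^3:ℝ)))) * cexp (n * ((u^2:ℝ) + I * (x*u^3:ℝ))) =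
      ((Real.exp (n * u^2) * PR (Real.exp (-u^2)) : ℝ) : ℂ) * FF u x := by
    intro x
    have e1 : cexp (n * ((u^2:ℝ) + I * (x*u^3:ℝ))) = (Real.exp (n * u^2) : ℝ) * ph x u := by
      rw [ph, Complex.ofReal_exp, ← Complex.exp_add]
      congr 1
      have : (n:ℂ) = π^2/(4*u^4) := by exact_mod_cast congrArg (fun r : ℝ => (r:ℂ)) hne
      rw [← this]
      push_cast
      ring
    rw [e1, FF, zz]
    have : ((PR (Real.exp (-u^2)) : ℝ) : ℂ) ≠ 0 := by exact_mod_cast hP.ne'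
    push_cast at this ⊢
    field_simp
  simp_rw [hfun] at hcv
  rw [intervalIntegral.integral_const_mul] at hcv
  have hu3 : ((u^3:ℝ):ℂ) ≠ 0 := by exact_mod_cast (by positivity : u^3 ≠ 0)
  rw [Complex.real_smul] at hcv
  have : (∫ θ in (-π)..π, VV 1 (cexp (-((u^2:ℝ) + I * θ))) * cexp (n * ((u^2:ℝ) + I * θ))) =
      ((u^3:ℝ):ℂ) * (((Real.exp (n * u^2) * PR (Real.exp (-u^2)) : ℝ) : ℂ) * ∫ x in (-(π/u^3))..(π/u^3), FF u x) := by
    rw [hcv, Complex.ofReal_inv, ← mul_assoc, mul_inv_cancel₀ hu3, one_mul]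
  rw [this]
  push_cast
  ring

/-- main growth -/
def DD (n : ℕ) : ℝ := Real.exp (π * √n) / (n:ℝ)^((3:ℝ)/4)

lemma DD_pos (n : ℕ) (hn : 0 < n) : 0 < DD n := by unfold DD; positivity

/-- slowly varying factor -/
def HH (u : ℝ) : ℝ := √(π/2)^3 * (√2)⁻¹^3 * Real.exp (u^2/8) * ‖GG ((u^2:ℝ):ℂ)‖^3

lemma HH_tendsto : Tendsto HH (𝓝[>] 0) (𝓝 (√(π/2)^3 * (√2)⁻¹^3)) := by
  have h1 : Tendsto (fun u : ℝ => ‖GG ((u^2:ℝ):ℂ)‖) (𝓝[>] 0) (𝓝 1) := by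
    have := (GG_tendsto 0).norm
    simpa [zz] using this
  have h2 : Tendsto (fun u : ℝ => Real.exp (u^2/8)) (𝓝[>] 0) (𝓝 1) := by
    have : Continuous (fun u : ℝ => Real.exp (u^2/8)) := by fun_prop
    have h := this.tendsto 0
    simp only [ne_eq, OfNat.ofNat_ne_zero, not_false_eq_true, zero_pow, zero_div, Real.exp_zero] at h
    exact h.mono_left nhdsWithin_le_nhds
  have := (h2.const_mul (√(π/2)^3 * (√2)⁻¹^3)).mul (h1.pow 3)
  simp only [mul_one, one_pow] at this
  exact this

lemma growth_eq (n : ℕ) (hn : 0 < n) :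
    uu n^3 * Real.exp (n * uu n^2) * PR (Real.exp (-uu n^2)) = DD n * HH (uu n) := by
  have hpi := Real.pi_pos
  have hu := uu_pos n hn
  have hn' : (0:ℝ) < n := by exact_mod_cast hn
  rw [PR_eq _ (by positivity : 0 < uu n^2), DD, HH]
  have e1 : Real.exp (n * uu n^2) * Real.exp (uu n^2/8 + π^2/(4*uu n^2)) =
      Real.exp (π*√n) * Real.exp (uu n^2/8) := by
    rw [← Real.exp_add, ← Real.exp_add]
    congr 1
    rw [uu_sq]
    have hs : 0 < √(n:ℝ) := by positivity
    have h2 : (n:ℝ) = √(n:ℝ)^2 := (Real.sq_sqrt hn'.le).symm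
    rw [h2, Real.sqrt_sq hs.le]
    field_simp
    ring
  have e2 : uu n^3 = √(π/2)^3 / (n:ℝ)^((3:ℝ)/4) := by
    rw [uu, div_pow]
    congr 1
    rw [Real.sqrt_eq_rpow, Real.sqrt_eq_rpow, ← Real.rpow_mul hn'.le, ← Real.rpow_natCast, ← Real.rpow_mul hn'.le]
    norm_num
  rw [e2]
  calc _ = √(π/2)^3 / (n:ℝ)^((3:ℝ)/4) * (√2)⁻¹^3 * (Real.exp (n * uu n^2) * Real.exp (uu n^2/8 + π^2/(4*uu n^2))) *
        ‖GG ((uu n^2:ℝ):ℂ)‖^3 := by ring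
    _ = _ := by rw [e1]; ring

lemma coef_one_asymp : Tendsto (fun n => coefOB 1 n / (DD n : ℝ)) atTop (𝓝 (1/16)) := by
  have h1 := int_tendsto.comp uu_tendsto
  have h2 := (Complex.continuous_ofReal.tendsto _).comp (HH_tendsto.comp uu_tendsto)
  have h3 := h2.mul (h1.const_mul (1/(2*π:ℂ)))
  have hpi := Real.pi_pos
  have hc : (((√(π/2)^3 * (√2)⁻¹^3 : ℝ)) : ℂ) * (1/(2*π:ℂ) * ((√π)⁻¹ : ℝ)) = 1/16 := by
    have : √(π/2)^3 * (√2)⁻¹^3 * (1/(2*π) * (√π)⁻¹) = 1/16 := by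
      rw [Real.sqrt_div hpi.le]
      have a : √π^2 = π := Real.sq_sqrt hpi.le
      have b : √2^2 = 2 := Real.sq_sqrt (by norm_num)
      have b6 : √2^6 = 8 := by rw [show √2^6 = (√2^2)^3 by ring, b]; norm_num
      field_simp
      rw [b6, a]; ring
    have h' := congrArg (fun r : ℝ => (r:ℂ)) this
    push_cast at h' ⊢
    exact h'
  rw [hc] at h3
  refine h3.congr' ?_
  filter_upwards [eventually_gt_atTop 0] with n hn
  rw [coef_int n hn, growth_eq n hn]
  have : ((DD n : ℝ):ℂ) ≠ 0 := by exact_mod_cast (DD_pos n hn).ne'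
  simp only [Function.comp_apply]
  push_cast
  field_simp

lemma coef_w_small (w : ℂ) (hw : ‖w‖ = 1) (hre : |w.re| < 1) :
    Tendsto (fun n => coefOB w n / (DD n : ℝ)) atTop (𝓝 0) := by
  have hpi := Real.pi_pos
  obtain ⟨δ, hδ, hb⟩ := VV_w_bound w hw hre
  have hlim : Tendsto (fun n => 48/δ^4 * (uu n^3 * HH (uu n))) atTop (𝓝 0) := by
    have h1 : Tendsto (fun u : ℝ => u^3) (𝓝[>] 0) (𝓝 0) := by
      have h := (continuous_pow (M := ℝ) 3).tendsto 0
      simp only [ne_eq, OfNat.ofNat_ne_zero, not_false_eq_true, zero_pow] at h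
      exact h.mono_left nhdsWithin_le_nhds
    have := (((h1.mul HH_tendsto).comp uu_tendsto)).const_mul (48/δ^4)
    simpa [Function.comp_def] using this
  refine squeeze_zero_norm' ?_ hlim
  have hsm : ∀ᶠ n in atTop, uu n^2 ≤ 1/2 := by
    have := (sq_tend.comp uu_tendsto).mono_right nhdsWithin_le_nhds
    exact this.eventually (eventually_le_nhds (by norm_num))
  filter_upwards [eventually_gt_atTop 0, hsm] with n hn hs
  have hu := uu_pos n hn
  have hD := DD_pos n hn
  have hg := growth_eq n hn
  have hP := PR_pos (uu n^2) (by positivity)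
  rw [norm_div, Complex.norm_real, Real.norm_of_nonneg hD.le, div_le_iff₀ hD]
  set u := uu n
  have ht : 0 < u^2 := by positivity
  have hr2 : Real.exp (-u^2) ≤ 1 - u^2/2 := by
    have h : 1 + u^2 ≤ Real.exp (u^2) := by have := Real.add_one_le_exp (u^2); linarith
    rw [Real.exp_neg, inv_le_comm₀ (Real.exp_pos _) (by linarith)]
    refine le_trans ?_ h
    rw [inv_le_iff_one_le_mul₀ (by linarith)]
    nlinarith
  have hVb : ∀ θ : ℝ, ‖VV w (cexp (-((u^2:ℝ) + I * θ)))‖ ≤ 48/δ^4*u^6 * PR (Real.exp (-u^2)) := by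
    intro θ
    have hnorm : ‖cexp (-((u^2:ℝ) + I * θ))‖ = Real.exp (-u^2) := by
      rw [Complex.norm_exp]; simp [← Complex.ofReal_pow]
    refine (hb (u^2) ht hs _ hnorm).trans ?_
    rw [div_le_iff₀ (by linarith)]
    calc Real.exp (-δ/u^2) * PR (Real.exp (-u^2)) ≤ 24/δ^4*(u^2)^4 * PR (Real.exp (-u^2)) := by
          gcongr; exact exp_small δ hδ ht
      _ = 48/δ^4*u^6 * PR (Real.exp (-u^2)) * (u^2/2) := by ring
      _ ≤ _ := by gcongr; linarith
  rw [cauchy_coef w hw (u^2) ht n, norm_mul]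
  have hi : ‖∫ θ in (-π)..π, VV w (cexp (-((u^2:ℝ) + I * θ))) * cexp (n * ((u^2:ℝ) + I * θ))‖ ≤
      (48/δ^4*u^6 * PR (Real.exp (-u^2)) * Real.exp (n*u^2)) * |π - -π| := by
    apply intervalIntegral.norm_integral_le_of_norm_le_const
    intro θ _
    rw [norm_mul]
    have : ‖cexp (n * ((u^2:ℝ) + I * θ))‖ = Real.exp (n*u^2) := by
      rw [Complex.norm_exp]; simp [← Complex.ofReal_pow]
    rw [this]
    gcongr
    exact hVb θ
  have hc : ‖(1/(2*π:ℂ))‖ = 1/(2*π) := by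
    have : (1/(2*π:ℂ)) = ((1/(2*π):ℝ):ℂ) := by push_cast; rfl
    rw [this, Complex.norm_real, Real.norm_of_nonneg (by positivity)]
  rw [hc]
  have hab : |π - -π| = 2*π := by rw [abs_of_pos] <;> linarith
  rw [hab] at hi
  calc _ ≤ 1/(2*π) * ((48/δ^4*u^6 * PR (Real.exp (-u^2)) * Real.exp (n*u^2)) * (2*π)) := by gcongr
    _ = 48/δ^4*u^3*(u^3 * Real.exp (n * u^2) * PR (Real.exp (-u^2))) := by field_simp
    _ = _ := by rw [hg]; ring

lemma root_re (c j : ℕ) (hc : 1 < c) (hodd : Odd c) (hj0 : j ≠ 0) (hj : j < c) :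
    ‖cexp (2 * π * I / c) ^ j‖ = 1 ∧ |(cexp (2 * π * I / c) ^ j).re| < 1 := by
  have hζ := Complex.isPrimitiveRoot_exp c (by omega)
  have hn : ‖cexp (2 * π * I / c) ^ j‖ = 1 := by
    rw [norm_pow, hζ.norm'_eq_one (by omega), one_pow]
  refine ⟨hn, lt_of_le_of_ne ((Complex.abs_re_le_norm _).trans hn.le) fun h => ?_⟩
  set w := cexp (2 * π * I / c) ^ j with hw
  have h1 : w.re^2 = 1 := by rw [← sq_abs, h, one_pow]
  have h2 : w.re*w.re + w.im*w.im = 1 := by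
    rw [← Complex.normSq_apply, Complex.normSq_eq_norm_sq, hn, one_pow]
  have h3 : w.im = 0 := by nlinarith
  have h4 : w^2 = 1 := by
    apply Complex.ext <;> simp [sq, h3]
    nlinarith
  rw [hw, ← pow_mul] at h4
  have h5 := (hζ.pow_eq_one_iff_dvd _).1 h4
  have h6 : c ∣ j := (Nat.Coprime.dvd_of_dvd_mul_right (hodd.coprime_two_right) h5)
  exact absurd (Nat.le_of_dvd (by omega) h6) (by omega)

theorem oddBalancedCountMod_asymp_exp (a : ℤ) (c : ℕ) (hc : 1 < c) (hcodd : Odd c) :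
    Tendsto (fun n : ℕ => (oddBalancedCountMod a c n : ℝ) /
      (Real.exp (π * Real.sqrt n) / (16 * c * (n : ℝ) ^ ((3 : ℝ) / 4))))
      atTop (nhds 1) := by
  have hlim : Tendsto (fun n => ∑ j ∈ Finset.range c,
      (cexp (2 * π * I / c)) ^ (-a * j) * (coefOB (cexp (2 * π * I / c) ^ j) n / (DD n : ℝ))) atTop
      (𝓝 (∑ j ∈ Finset.range c, if j = 0 then (1/16 : ℂ) else 0)) := by
    refine tendsto_finsetSum _ fun j hj => ?_
    split_ifs with h
    · subst h
      simpa using coef_one_asymp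
    · obtain ⟨h1, h2⟩ := root_re c j hc hcodd h (Finset.mem_range.1 hj)
      simpa using (coef_w_small _ h1 h2).const_mul ((cexp (2 * π * I / c)) ^ (-a * j))
  rw [Finset.sum_ite_eq' , if_pos (Finset.mem_range.2 (by omega))] at hlim
  have h2 := (Complex.continuous_re.tendsto _).comp (hlim.const_mul 16)
  have h3 : ((16:ℂ) * (1/16)).re = 1 := by norm_num
  rw [h3] at h2
  refine h2.congr fun n => ?_
  have e : ∑ j ∈ Finset.range c, (cexp (2 * π * I / c)) ^ (-a * j) * (coefOB (cexp (2 * π * I / c) ^ j) n / (DD n : ℝ))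
      = (c:ℂ) * (oddBalancedCountMod a c n : ℂ) / (DD n : ℝ) := by
    rw [countMod_eq a c hc n, Finset.sum_div]
    simp_rw [mul_div_assoc]
  simp only [Function.comp_apply]
  rw [e]
  have e2 : (16:ℂ) * ((c:ℂ) * (oddBalancedCountMod a c n : ℂ) / (DD n : ℝ)) =
      ((16 * (c * oddBalancedCountMod a c n / DD n) : ℝ) : ℂ) := by push_cast; rfl
  rw [e2, Complex.ofReal_re, DD]
  have : (c:ℝ) ≠ 0 := by positivity
  rw [div_div_eq_mul_div, div_div_eq_mul_div, mul_div_assoc']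
  congr 1
  ring
end
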